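/- arXiv:1712.03456 — 2 statements merged into one kernel-verified Lean document; each statement's English description precedes it below -/
import Mathlib

section
/- Let r ≥ 2 with prime factorization r = 2^{α_0} p_1^{α_1} ⋯ p_t^{α_t} (p_i distinct odd primes), and set b(r) = 2^{α_0}(p_1-1)^{α_1}⋯(p_t-1)^{α_t}. Let 2 ≤ s ≤ b(r), k ≥ 1, n ≥ sk. Then any coloring of the k-subsets of [n] with fewer than ⌈((s-1)n - r(k-1))/(r-1)⌉ colors admits r (not necessarily distinct) k-subsets of the same color such that every s of them (counted with multiplicity) have empty common intersection. -/
open Finset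

/-- Ceiling division on naturals: `⌈a / b⌉`. -/
def cld (a b : ℕ) : ℕ := (a + b - 1) / b

/-- `P` is a partition of `Fin N` indexed by `Fin n`. -/
def IsPartition {N n : ℕ} (P : Fin n → Finset (Fin N)) : Prop :=
  (∀ i j, i ≠ j → Disjoint (P i) (P j)) ∧ ∀ x, ∃ i, x ∈ P i

/-- `σ` is transversal to the partition `P`: it meets each part in at most one element. -/
def Transversal {N n : ℕ} (P : Fin n → Finset (Fin N)) (σ : Finset (Fin N)) : Prop :=
  ∀ i, (σ ∩ P i).card ≤ 1

/-- A set `σ ⊆ [n]` is `t`-wide: it is not contained in any interval of length `t`. -/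
def Wide (n t : ℕ) (σ : Finset (Fin n)) : Prop :=
  ∀ a : ℕ, ¬ ∀ x ∈ σ, a ≤ x.val ∧ x.val < a + t

/-- Cyclic distance between two elements of `[n]`. -/
def cycDist (n : ℕ) (x y : Fin n) : ℕ :=
  min (max x.val y.val - min x.val y.val) (n - (max x.val y.val - min x.val y.val))

/-- `σ` is `s`-stable: any two of its elements are at cyclic distance at least `s`. -/
def Stable (n s : ℕ) (σ : Finset (Fin n)) : Prop :=
  ∀ x ∈ σ, ∀ y ∈ σ, x ≠ y → s ≤ cycDist n x y

/-- `b(r) = 2^{α₀}(p₁-1)^{α₁}⋯(p_t-1)^{α_t}` for `r = 2^{α₀}p₁^{α₁}⋯p_t^{α_t}`. -/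
def bfun (r : ℕ) : ℕ := r.factorization.prod fun p a => (if p = 2 then 2 else p - 1) ^ a

/-- Proper coloring of `KG^r(n,k)`: no `r` pairwise disjoint `k`-subsets monochromatic. -/
def ProperKG (r n k : ℕ) {m : ℕ} (c : Finset (Fin n) → Fin m) : Prop :=
  ∀ A : Fin r → Finset (Fin n), (∀ j, (A j).card = k) →
    (∀ j j', j ≠ j' → Disjoint (A j) (A j')) →
    ¬ ∀ j j', c (A j) = c (A j')

noncomputable def chiKG (r n k : ℕ) : ℕ :=
  sInf {m | ∃ c : Finset (Fin n) → Fin m, ProperKG r n k c}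

/-- Proper coloring of `KG^r(N,k;P)` (vertices: transversal `k`-subsets). -/
def ProperP (r N k : ℕ) {ℓ : ℕ} (P : Fin ℓ → Finset (Fin N)) {m : ℕ}
    (c : Finset (Fin N) → Fin m) : Prop :=
  ∀ A : Fin r → Finset (Fin N), (∀ j, (A j).card = k) →
    (∀ j, Transversal P (A j)) →
    (∀ j j', j ≠ j' → Disjoint (A j) (A j')) →
    ¬ ∀ j j', c (A j) = c (A j')

noncomputable def chiP (r N k : ℕ) {ℓ : ℕ} (P : Fin ℓ → Finset (Fin N)) : ℕ :=
  sInf {m | ∃ c : Finset (Fin N) → Fin m, ProperP r N k P c}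

/-- Proper coloring of `KG^r_s(n,k)`: a hyperedge is an `r`-tuple of `k`-subsets such that
each `i ∈ [n]` lies in at most `s i` of them. -/
def ProperS (r n k : ℕ) (s : Fin n → ℕ) {m : ℕ} (c : Finset (Fin n) → Fin m) : Prop :=
  ∀ A : Fin r → Finset (Fin n), (∀ j, (A j).card = k) →
    (∀ i : Fin n, ((univ : Finset (Fin r)).filter fun j => i ∈ A j).card ≤ s i) →
    ¬ ∀ j j', c (A j) = c (A j')

noncomputable def chiS (r n k : ℕ) (s : Fin n → ℕ) : ℕ :=
  sInf {m | ∃ c : Finset (Fin n) → Fin m, ProperS r n k s c}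

/-- Proper coloring of `KG^r_A(n,k)` (vertices: `k`-subsets not contained in `A`). -/
def ProperA (r n k : ℕ) (A : Finset (Fin n)) {m : ℕ} (c : Finset (Fin n) → Fin m) : Prop :=
  ∀ B : Fin r → Finset (Fin n), (∀ j, (B j).card = k) → (∀ j, ¬ B j ⊆ A) →
    (∀ j j', j ≠ j' → Disjoint (B j) (B j')) →
    ¬ ∀ j j', c (B j) = c (B j')

noncomputable def chiA (r n k : ℕ) (A : Finset (Fin n)) : ℕ :=
  sInf {m | ∃ c : Finset (Fin n) → Fin m, ProperA r n k A c}

/-- Proper coloring of the `r`-stable subhypergraph `KG^r(n,k)_{r-stab}`. -/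
def ProperStab (r n k : ℕ) {m : ℕ} (c : Finset (Fin n) → Fin m) : Prop :=
  ∀ A : Fin r → Finset (Fin n), (∀ j, (A j).card = k) → (∀ j, Stable n r (A j)) →
    (∀ j j', j ≠ j' → Disjoint (A j) (A j')) →
    ¬ ∀ j j', c (A j) = c (A j')

noncomputable def chiStab (r n k : ℕ) : ℕ :=
  sInf {m | ∃ c : Finset (Fin n) → Fin m, ProperStab r n k c}

/-- Proper coloring of `KG^r(N,k;P)_{t-wide}` (vertices: `t`-wide transversal `k`-subsets). -/
def ProperPW (r N k t : ℕ) {ℓ : ℕ} (P : Fin ℓ → Finset (Fin N)) {m : ℕ}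
    (c : Finset (Fin N) → Fin m) : Prop :=
  ∀ A : Fin r → Finset (Fin N), (∀ j, (A j).card = k) →
    (∀ j, Transversal P (A j)) → (∀ j, Wide N t (A j)) →
    (∀ j j', j ≠ j' → Disjoint (A j) (A j')) →
    ¬ ∀ j j', c (A j) = c (A j')

noncomputable def chiPW (r N k t : ℕ) {ℓ : ℕ} (P : Fin ℓ → Finset (Fin N)) : ℕ :=
  sInf {m | ∃ c : Finset (Fin N) → Fin m, ProperPW r N k t P c}

/-- Proper coloring of `KG^r_s(n,k)_{t-wide}` (vertices: `t`-wide `k`-subsets). -/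
def ProperSW (r n k t : ℕ) (s : Fin n → ℕ) {m : ℕ} (c : Finset (Fin n) → Fin m) : Prop :=
  ∀ A : Fin r → Finset (Fin n), (∀ j, (A j).card = k) → (∀ j, Wide n t (A j)) →
    (∀ i : Fin n, ((univ : Finset (Fin r)).filter fun j => i ∈ A j).card ≤ s i) →
    ¬ ∀ j j', c (A j) = c (A j')

noncomputable def chiSW (r n k t : ℕ) (s : Fin n → ℕ) : ℕ :=
  sInf {m | ∃ c : Finset (Fin n) → Fin m, ProperSW r n k t s c}

/-- Extension of `s : Fin n → ℕ` to `ℕ` by zero. -/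
def sE {n : ℕ} (s : Fin n → ℕ) (i : ℕ) : ℕ := if h : i < n then s ⟨i, h⟩ else 0

/-- `blockSum s j t = s_j + s_{j+1} + ⋯ + s_{j+t-1}`. -/
def blockSum {n : ℕ} (s : Fin n → ℕ) (j t : ℕ) : ℕ := ∑ i ∈ Finset.Ico j (j + t), sE s i

/-- The partition of `[N]` into consecutive blocks of sizes `s_1, …, s_n`. -/
def blocks {n : ℕ} (s : Fin n → ℕ) (N : ℕ) (j : Fin n) : Finset (Fin N) :=
  univ.filter fun x => blockSum s 0 j.val ≤ x.val ∧ x.val < blockSum s 0 (j.val + 1)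

namespace ZT

variable {p : ℕ}

/-- Vertices: a sign together with a level. -/
abbrev Vx (p : ℕ) := ZMod p × ℕ
/-- Chains: formal combinations of lists of vertices. -/
abbrev Ch (p : ℕ) := List (Vx p) →₀ ZMod p

noncomputable def cons (v : Vx p) : Ch p →ₗ[ZMod p] Ch p :=
  Finsupp.lmapDomain (ZMod p) (ZMod p) (List.cons v)

noncomputable def bdL : List (Vx p) → Ch p
  | [] => 0
  | v :: l => Finsupp.single l 1 - cons v (bdL l)

noncomputable def bd : Ch p →ₗ[ZMod p] Ch p := Finsupp.linearCombination (ZMod p) bdL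

lemma cons_single (v : Vx p) (l : List (Vx p)) (a : ZMod p) :
    cons v (Finsupp.single l a) = Finsupp.single (v :: l) a := by
  simp [cons]

lemma bd_single (l : List (Vx p)) : bd (Finsupp.single l 1) = bdL l := by
  simp [bd]

lemma bd_cons (v : Vx p) (c : Ch p) : bd (cons v c) = c - cons v (bd c) := by
  have : bd ∘ₗ cons v = LinearMap.id - cons v ∘ₗ bd := by
    apply Finsupp.lhom_ext'
    intro l
    apply LinearMap.ext_ring
    simp [cons_single, bd_single, bdL]
  simpa using LinearMap.congr_fun this c

lemma bd_bdL (l : List (Vx p)) : bd (bdL l) = 0 := by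
  induction l with
  | nil => simp [bdL]
  | cons v l ih => simp [bdL, bd_cons, bd_single, ih]

lemma bd_bd (c : Ch p) : bd (bd c) = 0 := by
  have : (bd : Ch p →ₗ[ZMod p] Ch p) ∘ₗ bd = 0 := by
    apply Finsupp.lhom_ext'
    intro l
    apply LinearMap.ext_ring
    simp [bd_single, bd_bdL]
  simpa using LinearMap.congr_fun this c

noncomputable def hh (F : List (Vx p) → Vx p) : ℕ → (Ch p →ₗ[ZMod p] Ch p)
  | 0 => Finsupp.linearCombination (ZMod p) fun _ => Finsupp.single [] 1
  | n + 1 => Finsupp.linearCombination (ZMod p) fun l => cons (F l) (hh F n (bdL l))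

lemma hh_succ_single (F : List (Vx p) → Vx p) (n : ℕ) (l : List (Vx p)) :
    hh F (n + 1) (Finsupp.single l 1) = cons (F l) (hh F n (bdL l)) := by
  simp [hh]

lemma bd_hh_zero (F : List (Vx p) → Vx p) (c : Ch p) : bd (hh F 0 c) = 0 := by
  have : bd ∘ₗ hh F 0 = 0 := by
    apply Finsupp.lhom_ext'
    intro l
    apply LinearMap.ext_ring
    simp [hh, bd_single, bdL]
  simpa using LinearMap.congr_fun this c

lemma bd_hh (F : List (Vx p) → Vx p) (n : ℕ) (c : Ch p) :
    bd (hh F (n + 1) c) = hh F n (bd c) := by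
  induction n generalizing c with
  | zero =>
    have : bd ∘ₗ hh F (0 + 1) = hh F 0 ∘ₗ bd := by
      apply Finsupp.lhom_ext'
      intro l
      apply LinearMap.ext_ring
      simp only [LinearMap.comp_apply, Finsupp.lsingle_apply, hh_succ_single, bd_cons, bd_hh_zero,
        bd_single, map_zero, sub_zero]
    simpa using LinearMap.congr_fun this c
  | succ n ih =>
    have : bd ∘ₗ hh F (n + 1 + 1) = hh F (n + 1) ∘ₗ bd := by
      apply Finsupp.lhom_ext'
      intro l
      apply LinearMap.ext_ring
      simp only [LinearMap.comp_apply, Finsupp.lsingle_apply, hh_succ_single F (n+1), bd_cons, ih,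
        bd_single, bd_bdL, map_zero, sub_zero]
    simpa using LinearMap.congr_fun this c

abbrev Sup (s : Set (List (Vx p))) : Submodule (ZMod p) (Ch p) :=
  Finsupp.supported (ZMod p) (ZMod p) s

lemma single_mem {s : Set (List (Vx p))} {l : List (Vx p)} (a : ZMod p) (h : l ∈ s) :
    Finsupp.single l a ∈ Sup s := Finsupp.single_mem_supported _ a h

lemma lc_mem {s : Set (List (Vx p))} {P : Submodule (ZMod p) (Ch p)} {c : Ch p} (hc : c ∈ Sup s)
    (f : Ch p →ₗ[ZMod p] Ch p) (hf : ∀ l ∈ s, f (Finsupp.single l 1) ∈ P) : f c ∈ P := by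
  rw [← Finsupp.sum_single c, Finsupp.sum, map_sum]
  refine Submodule.sum_mem _ fun l hl => ?_
  have : Finsupp.single l (c l) = c l • Finsupp.single l (1 : ZMod p) := by simp
  rw [this, map_smul]
  exact P.smul_mem _ (hf l (hc hl))

lemma lc_congr {s : Set (List (Vx p))} {c : Ch p} (hc : c ∈ Sup s)
    (f g : Ch p →ₗ[ZMod p] Ch p)
    (hf : ∀ l ∈ s, f (Finsupp.single l 1) = g (Finsupp.single l 1)) : f c = g c := by
  have := lc_mem (P := ⊥) hc (f - g) (by intro l hl; simp [hf l hl])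
  simpa [sub_eq_zero] using this

lemma cons_mem {s t : Set (List (Vx p))} {c : Ch p} (hc : c ∈ Sup s) (v : Vx p)
    (h : ∀ l ∈ s, v :: l ∈ t) : cons v c ∈ Sup t := by
  refine lc_mem hc _ fun l hl => ?_
  rw [cons_single]
  exact single_mem _ (h l hl)

lemma bdL_mem (l : List (Vx p)) :
    bdL l ∈ Sup {l' | l'.Sublist l ∧ l'.length + 1 = l.length} := by
  induction l with
  | nil => simp [bdL]
  | cons v l ih =>
    rw [bdL]
    refine Submodule.sub_mem _ (single_mem _ (by simp)) (cons_mem ih v ?_)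
    rintro l' ⟨h1, h2⟩
    exact ⟨h1.cons_cons v, by simp [h2]⟩

/-- strictly decreasing levels -/
def Strict (l : List (Vx p)) : Prop := l.Pairwise fun u v => v.2 < u.2

def Weak (l : List (Vx p)) : Prop := l.Pairwise fun u v => v.2 < u.2 ∨ u = v

lemma bdL_degen (l : List (Vx p)) (hw : Weak l) (hs : ¬ Strict l) :
    bdL l ∈ Sup {l' | ¬ Strict l'} := by
  induction l with
  | nil => exact absurd List.Pairwise.nil hs
  | cons u l ih =>
    have hw' := List.pairwise_cons.1 hw
    by_cases hl : Strict l
    · cases l with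
      | nil => exact absurd (List.pairwise_singleton _ _) hs
      | cons w l =>
        have hwu : u = w := by
          rcases hw'.1 w (by simp) with h | h
          · exfalso
            apply hs
            refine List.pairwise_cons.2 ⟨?_, hl⟩
            intro v hv
            rcases List.mem_cons.1 hv with rfl | hv
            · exact h
            · exact ((List.pairwise_cons.1 hl).1 v hv).trans h
          · exact h
        subst hwu
        simp only [bdL, map_sub, cons_single, sub_sub_cancel]
        refine cons_mem (s := {l' | ∃ m, l' = u :: m}) (cons_mem (bdL_mem l) u ?_) u ?_
        · intro m _; exact ⟨m, rfl⟩
        · rintro _ ⟨m, rfl⟩ h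
          have := (List.pairwise_cons.1 h).1 u (by simp)
          exact lt_irrefl _ this
    · rw [bdL]
      refine Submodule.sub_mem _ (single_mem _ hl) (cons_mem (ih hw'.2 hl) u ?_)
      intro l' h h'
      exact h (List.pairwise_cons.1 h').2

def sh (a : ZMod p) (v : Vx p) : Vx p := (v.1 + a, v.2)

lemma sh_inj (a : ZMod p) : Function.Injective (sh a : Vx p → Vx p) := by
  rintro ⟨x, i⟩ ⟨y, j⟩ h
  simpa [sh] using h

noncomputable def shC (a : ZMod p) : Ch p →ₗ[ZMod p] Ch p :=
  Finsupp.lmapDomain (ZMod p) (ZMod p) (List.map (sh a))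

lemma shC_single (a : ZMod p) (l : List (Vx p)) (x : ZMod p) :
    shC a (Finsupp.single l x) = Finsupp.single (l.map (sh a)) x := by
  simp [shC]

lemma shC_cons (a : ZMod p) (v : Vx p) (c : Ch p) :
    shC a (cons v c) = cons (sh a v) (shC a c) := by
  have : shC a ∘ₗ cons v = cons (sh a v) ∘ₗ shC a := by
    apply Finsupp.lhom_ext'
    intro l
    apply LinearMap.ext_ring
    simp [cons_single, shC_single]
  simpa using LinearMap.congr_fun this c

lemma bdL_sh (a : ZMod p) (l : List (Vx p)) : bdL (l.map (sh a)) = shC a (bdL l) := by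
  induction l with
  | nil => simp [bdL]
  | cons v l ih => simp [bdL, ih, shC_cons, shC_single]

def Good (m : ℕ) (l : List (Vx p)) : Prop := Strict l ∧ ∀ v ∈ l, v.2 < m

lemma Good.sub {m : ℕ} {l l' : List (Vx p)} (h : Good m l) (h' : l'.Sublist l) : Good m l' :=
  ⟨h.1.sublist h', fun v hv => h.2 v (h'.subset hv)⟩

lemma Good.sh {m : ℕ} {l : List (Vx p)} (h : Good m l) (a : ZMod p) : Good m (l.map (sh a)) := by
  refine ⟨?_, ?_⟩
  · have := h.1
    unfold Strict at *
    rw [List.pairwise_map]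
    exact this
  · intro v hv
    obtain ⟨w, hw, rfl⟩ := List.mem_map.1 hv
    exact h.2 w hw

open Classical in
noncomputable def SS [NeZero p] : ℕ → Finset (List (Vx p))
  | 0 => {[]}
  | m + 1 => SS m ∪ (univ ×ˢ SS m).image fun x : ZMod p × List (Vx p) => (x.1, m) :: x.2

lemma mem_SS [NeZero p] (m : ℕ) (l : List (Vx p)) : l ∈ SS m ↔ Good m l := by
  induction m generalizing l with
  | zero =>
    cases l with
    | nil => simp [SS, Good, Strict]
    | cons v l =>
      simp only [SS, mem_singleton, reduceCtorEq, false_iff]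
      intro h
      exact absurd (h.2 v (by simp)) (by omega)
  | succ m ih =>
    simp only [SS, mem_union, mem_image, mem_product, mem_univ, true_and, ih, Prod.exists]
    constructor
    · rintro (h | ⟨a, l, h, rfl⟩)
      · exact ⟨h.1, fun v hv => (h.2 v hv).trans (Nat.lt_succ_self m)⟩
      · refine ⟨List.pairwise_cons.2 ⟨fun v hv => h.2 v hv, h.1⟩, ?_⟩
        intro v hv
        rcases List.mem_cons.1 hv with rfl | hv
        · exact Nat.lt_succ_self m
        · exact (h.2 v hv).trans (Nat.lt_succ_self m)
    · intro h
      cases l with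
      | nil => left; exact ⟨h.1, by simp⟩
      | cons v l =>
        obtain ⟨h1, h2⟩ := List.pairwise_cons.1 h.1
        have hv := h.2 v (by simp)
        by_cases hvm : v.2 = m
        · right
          refine ⟨v.1, l, ⟨h2, fun w hw => hvm ▸ h1 w hw⟩, by rw [← hvm]⟩
        · left
          have : v.2 < m := by omega
          refine ⟨h.1, fun w hw => ?_⟩
          rcases List.mem_cons.1 hw with rfl | hw
          · exact this
          · exact (h1 w hw).trans this

section main
variable (M : ℕ) (F : List (Vx p) → Vx p)

lemma hh_mem (hmono : ∀ l l', Good (M+1) l → l'.Sublist l → l' ≠ [] →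
      (F l').2 < (F l).2 ∨ F l = F l') (n : ℕ) (l : List (Vx p)) (hl : Good (M+1) l)
    (hn : l.length = n) :
    hh F n (Finsupp.single l 1) ∈ Sup {t | Weak t ∧
      (∀ v ∈ t, ∃ l', l'.Sublist l ∧ l' ≠ [] ∧ v = F l')} := by
  induction n generalizing l with
  | zero =>
    simp only [hh, Finsupp.linearCombination_single, one_smul]
    exact single_mem _ ⟨List.Pairwise.nil, by simp⟩
  | succ n ih =>
    rw [hh_succ_single]
    have hne : l ≠ [] := by rintro rfl; simp at hn
    refine cons_mem (s := {t | Weak t ∧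
      (∀ v ∈ t, ∃ l', l'.Sublist l ∧ l' ≠ [] ∧ v = F l')}) ?_ _ ?_
    · refine lc_mem (bdL_mem l) _ ?_
      rintro l' ⟨h1, h2⟩
      refine Finsupp.supported_mono ?_ (ih l' (hl.sub h1) (by omega))
      rintro t ⟨ht1, ht2⟩
      refine ⟨ht1, fun v hv => ?_⟩
      obtain ⟨l'', h3, h4, h5⟩ := ht2 v hv
      exact ⟨l'', h3.trans h1, h4, h5⟩
    · rintro t ⟨ht1, ht2⟩
      refine ⟨List.pairwise_cons.2 ⟨?_, ht1⟩, ?_⟩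
      · intro v hv
        obtain ⟨l', h3, h4, rfl⟩ := ht2 v hv
        exact hmono l l' hl h3 h4
      · intro v hv
        rcases List.mem_cons.1 hv with rfl | hv
        · exact ⟨l, List.Sublist.refl l, hne, rfl⟩
        · exact ht2 v hv

lemma hh_sh (hE : ∀ l a, Good (M+1) l → l ≠ [] → F (l.map (sh a)) = sh a (F l))
    (a : ZMod p) (n : ℕ) (l : List (Vx p)) (hl : Good (M+1) l) (hn : l.length = n) :
    hh F n (Finsupp.single (l.map (sh a)) 1) = shC a (hh F n (Finsupp.single l 1)) := by
  induction n generalizing l with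
  | zero => simp [hh, shC_single]
  | succ n ih =>
    have hne : l ≠ [] := by rintro rfl; simp at hn
    rw [hh_succ_single, hh_succ_single, hE l a hl hne, shC_cons, bdL_sh]
    congr 1
    refine lc_congr (bdL_mem l) (hh F n ∘ₗ shC a) (shC a ∘ₗ hh F n) ?_
    rintro l' ⟨h1, h2⟩
    simp only [LinearMap.comp_apply, shC_single]
    exact ih l' (hl.sub h1) (by omega)

lemma apply_bd (c : Ch p) (s : Finset (List (Vx p))) (σ : List (Vx p))
    (h : ∀ t, c t ≠ 0 → t ∉ s → bdL t σ = 0) :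
    (bd c) σ = ∑ t ∈ s, c t * (bdL t) σ := by
  classical
  rw [bd, Finsupp.linearCombination_apply, Finsupp.sum, Finsupp.finsetSum_apply]
  simp only [Finsupp.smul_apply, smul_eq_mul]
  have h1 : ∑ t ∈ c.support, c t * bdL t σ = ∑ t ∈ c.support ∩ s, c t * bdL t σ := by
    refine (sum_subset inter_subset_left ?_).symm
    intro t ht ht'
    rw [h t (by simpa using ht) (by simp_all), mul_zero]
  rw [h1]
  refine sum_subset inter_subset_right ?_
  intro t ht ht'
  have : c t = 0 := by
    by_contra h0
    exact ht' (by simp [ht, h0])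
  rw [this, zero_mul]

lemma lin_apply (f : Ch p →ₗ[ZMod p] Ch p) (c : Ch p) (s : Finset (List (Vx p)))
    (h : c ∈ Sup (s : Set (List (Vx p)))) (σ : List (Vx p)) :
    (f c) σ = ∑ t ∈ s, c t * (f (Finsupp.single t 1)) σ := by
  classical
  have hc : c = ∑ t ∈ s, c t • Finsupp.single t (1 : ZMod p) := by
    conv_lhs => rw [← Finsupp.sum_single c]
    rw [Finsupp.sum_of_support_subset c (s := s) (by exact_mod_cast h) _ (by simp)]
    simp
  conv_lhs => rw [hc]
  simp [Finsupp.finsetSum_apply, -Finsupp.smul_single]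

theorem tucker [NeZero p] (hp : 2 ≤ p)
    (hM : ∀ l, Good (M+1) l → l ≠ [] → (F l).2 < M)
    (hE : ∀ l a, Good (M+1) l → l ≠ [] → F (l.map (sh a)) = sh a (F l))
    (hmono : ∀ l l', Good (M+1) l → l'.Sublist l → l' ≠ [] →
      (F l').2 < (F l).2 ∨ F l = F l') : False := by
  classical
  have : Fact (1 < p) := ⟨hp⟩
  set e : Vx p := (0, M) with he
  set f : List (Vx p) → ZMod p := fun σ =>
    (-1) ^ σ.length * hh F σ.length (Finsupp.single σ 1) σ with hf
  have hgood : ∀ σ, Good M σ → Good (M+1) (e :: σ) := by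
    intro σ h
    refine ⟨List.pairwise_cons.2 ⟨fun v hv => h.2 v hv, h.1⟩, ?_⟩
    intro v hv
    rcases List.mem_cons.1 hv with rfl | hv
    · exact Nat.lt_succ_self M
    · exact (h.2 v hv).trans (Nat.lt_succ_self M)
  have hT : ∑ σ ∈ SS M, f σ = 0 := by
    have key : ∀ σ ∈ SS M, f σ =
        (∑ τ ∈ SS M, (-1) ^ σ.length * (hh F (σ.length + 1) (Finsupp.single (e :: σ) 1) τ *
          bdL τ σ)) +
        (∑ τ ∈ SS M, (-1) ^ σ.length * (bdL σ τ *
          hh F (τ.length + 1) (Finsupp.single (e :: τ) 1) σ)) := by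
      intro σ hσ
      have hσg := (mem_SS M σ).1 hσ
      have e1 : (Finsupp.single σ 1 : Ch p) = bd (Finsupp.single (e :: σ) 1) + cons e (bdL σ) := by
        rw [bd_single, bdL]; abel
      rw [← mul_sum, ← mul_sum, ← mul_add]
      show (-1) ^ σ.length * _ = _
      congr 1
      have e2 : hh F σ.length (Finsupp.single σ 1) =
          bd (hh F (σ.length + 1) (Finsupp.single (e :: σ) 1)) +
          hh F σ.length (cons e (bdL σ)) := by
        rw [bd_hh, ← map_add, ← e1]
      rw [e2, Finsupp.add_apply]
      congr 1
      · apply apply_bd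
        intro t ht hts
        have hmem := hh_mem M F hmono (σ.length + 1) (e :: σ) (hgood σ hσg) (by simp)
        have htt := hmem (show t ∈ _ by simpa using ht)
        obtain ⟨hw, hv⟩ := htt
        have hns : ¬ Strict t := by
          intro hst
          apply hts
          rw [mem_SS]
          refine ⟨hst, fun v hv' => ?_⟩
          obtain ⟨l', h1, h2, rfl⟩ := hv v hv'
          exact hM l' ((hgood σ hσg).sub h1) h2
        have hb := bdL_degen t hw hns
        by_contra h0
        exact (hb (show σ ∈ _ by simpa using h0)) hσg.1
      · have hsup : bdL σ ∈ Sup (((SS M).filter fun l' : List (Vx p) => l'.length + 1 = σ.length :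
            Finset (List (Vx p))) : Set (List (Vx p))) := by
          refine Finsupp.supported_mono ?_ (bdL_mem σ)
          rintro l' ⟨h1, h2⟩
          simp only [coe_filter, Set.mem_ofPred_eq]
          exact ⟨(mem_SS M l').2 (hσg.sub h1), h2⟩
        rw [← LinearMap.comp_apply, lin_apply (hh F σ.length ∘ₗ cons e) _ _ hsup]
        rw [sum_filter]
        refine sum_congr rfl fun τ hτ => ?_
        split_ifs with hlen
        · rw [hlen, LinearMap.comp_apply, cons_single]
        · have : bdL σ τ = 0 := by
            by_contra h0
            exact hlen (bdL_mem σ (show τ ∈ _ by simpa using h0)).2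
          rw [this, zero_mul]
    rw [sum_congr rfl key, sum_add_distrib]
    rw [sum_comm (s := SS M) (t := SS M)]
    rw [← sum_add_distrib]
    refine sum_eq_zero fun σ hσ => ?_
    rw [← sum_add_distrib]
    refine sum_eq_zero fun τ hτ => ?_
    by_cases h0 : bdL σ τ = 0
    · rw [h0]; ring
    · have := (bdL_mem σ (show τ ∈ _ by simpa using h0)).2
      rw [← this, pow_succ]
      ring
  have hnil : ([] : List (Vx p)) ∈ SS M := (mem_SS M _).2 ⟨List.Pairwise.nil, by simp⟩
  rw [← add_sum_erase _ _ hnil] at hT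
  have hf0 : f [] = 1 := by simp [hf, hh]
  have hfs : ∀ σ a, Good M σ → f (σ.map (sh a)) = f σ := by
    intro σ a hσ
    have hσ' : Good (M+1) σ := ⟨hσ.1, fun v hv => (hσ.2 v hv).trans (Nat.lt_succ_self M)⟩
    simp only [hf, List.length_map]
    rw [hh_sh M F hE a _ σ hσ' rfl]
    congr 1
    exact Finsupp.mapDomain_apply ((List.map_injective_iff).2 (sh_inj a)) _ _
  have hrest : ∑ σ ∈ (SS M).erase [], f σ = 0 := by
    rw [← sum_fiberwise (s := (SS M).erase []) (g := fun σ => (σ.head?.getD e).1) (f := f)]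
    have : ∀ a : ZMod p, ∑ σ ∈ ((SS M).erase []) with (σ.head?.getD e).1 = a, f σ =
        ∑ σ ∈ ((SS M).erase []) with (σ.head?.getD e).1 = 0, f σ := by
      intro a
      refine sum_nbij' (fun σ => σ.map (sh (-a))) (fun σ => σ.map (sh a)) ?_ ?_ ?_ ?_ ?_
      · intro σ hσ
        simp only [mem_filter, mem_erase, mem_SS] at hσ ⊢
        obtain ⟨⟨h1, h2⟩, h3⟩ := hσ
        refine ⟨⟨by simpa using h1, h2.sh _⟩, ?_⟩
        cases σ with
        | nil => simp at h1
        | cons v l => simp at h3; simp [sh, h3]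
      · intro σ hσ
        simp only [mem_filter, mem_erase, mem_SS] at hσ ⊢
        obtain ⟨⟨h1, h2⟩, h3⟩ := hσ
        refine ⟨⟨by simpa using h1, h2.sh _⟩, ?_⟩
        cases σ with
        | nil => simp at h1
        | cons v l => simp at h3; simp [sh, h3]
      · intro σ _
        simp [sh, Function.comp_def]
      · intro σ _
        simp [sh, Function.comp_def]
      · intro σ hσ
        simp only [mem_filter, mem_erase, mem_SS] at hσ
        exact (hfs σ _ hσ.1.2).symm
    rw [sum_congr rfl fun a _ => this a]
    simp [ZMod.card]
  rw [hf0, hrest, add_zero] at hT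
  exact one_ne_zero hT

end main
end ZT

namespace ZT

variable {p : ℕ}

def Nontriv [NeZero p] (T : Finset (ZMod p)) : Prop := T.Nonempty ∧ T ≠ univ

def Shifted (a : ZMod p) (T T' : Finset (ZMod p)) : Prop := ∀ g, g ∈ T' ↔ g - a ∈ T

lemma Shifted.eq {a : ZMod p} {T T' : Finset (ZMod p)} (h : Shifted a T T') :
    T' = T.map (addRightEmbedding a) := by
  ext g
  rw [h g]
  simp only [mem_map, addRightEmbedding_apply]
  constructor
  · intro h; exact ⟨g - a, h, by ring⟩
  · rintro ⟨x, hx, rfl⟩; simpa using hx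

lemma Shifted.card {a : ZMod p} {T T' : Finset (ZMod p)} (h : Shifted a T T') : #T' = #T := by
  rw [h.eq, card_map]

lemma nontriv_iff [NeZero p] (T : Finset (ZMod p)) : Nontriv T ↔ 0 < #T ∧ #T < p := by
  unfold Nontriv
  rw [card_pos]
  have h1 : #T ≤ p := by
    have := card_le_univ T
    rwa [ZMod.card] at this
  have h2 : T = univ ↔ #T = p := by
    rw [← card_eq_iff_eq_univ, ZMod.card]
  rw [Ne, h2]
  constructor
  · rintro ⟨h, h'⟩; exact ⟨h, by omega⟩
  · rintro ⟨h, h'⟩; exact ⟨h, by omega⟩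

/-- the center of mass of a set of residues -/
noncomputable def cm [Fact p.Prime] (T : Finset (ZMod p)) : ZMod p := (∑ x ∈ T, x) / (#T : ZMod p)

lemma cm_shift [Fact p.Prime] {a : ZMod p} {T T' : Finset (ZMod p)} (h : Shifted a T T')
    (hT : Nontriv T) : cm T' = cm T + a := by
  obtain ⟨h1, h2⟩ := (nontriv_iff T).1 hT
  have h3 : (#T : ZMod p) ≠ 0 := by
    intro h0
    rw [ZMod.natCast_eq_zero_iff] at h0
    exact absurd (Nat.le_of_dvd h1 h0) (by omega)
  unfold cm
  rw [h.card, h.eq, sum_map]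
  simp only [addRightEmbedding_apply, sum_add_distrib, sum_const, nsmul_eq_mul]
  field_simp

noncomputable def pick [Fact p.Prime] (T : ℕ → Finset (ZMod p)) : ZMod p :=
  cm (T (sInf {i | Nontriv (T i)}))

lemma Shifted.nontriv [NeZero p] {a : ZMod p} {T T' : Finset (ZMod p)} (h : Shifted a T T') :
    Nontriv T' ↔ Nontriv T := by
  rw [nontriv_iff, nontriv_iff, h.card]

lemma pick_shift [Fact p.Prime] {a : ZMod p} {T T' : ℕ → Finset (ZMod p)}
    (h : ∀ i, Shifted a (T i) (T' i)) (hT : ∃ i, Nontriv (T i)) : pick T' = pick T + a := by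
  have h1 : {i | Nontriv (T' i)} = {i | Nontriv (T i)} := by
    ext i; exact (h i).nontriv
  unfold pick
  rw [h1]
  exact cm_shift (h _) (Nat.sInf_mem (s := {i | Nontriv (T i)}) hT)

lemma fam_eq {T T' : ℕ → Finset (ZMod p)} (I : Finset ℕ) (hsub : ∀ i, T i ⊆ T' i)
    (hoff' : ∀ i, i ∉ I → T' i = ∅) (hs : ∑ i ∈ I, #(T' i) ≤ ∑ i ∈ I, #(T i)) : T = T' := by
  have h1 : ∀ i ∈ I, #(T i) ≤ #(T' i) := fun i _ => card_le_card (hsub i)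
  have h2 := (sum_eq_sum_iff_of_le h1).1 (le_antisymm (sum_le_sum h1) hs)
  funext i
  by_cases hi : i ∈ I
  · exact eq_of_subset_of_card_le (hsub i) (h2 i hi).ge
  · have := hsub i
    rw [hoff' i hi] at this ⊢
    exact subset_empty.1 this

open Classical in
/-- signs occurring in block `i` -/
noncomputable def sg [NeZero p] (B : ℕ → ℕ) (l : List (Vx p)) (i : ℕ) : Finset (ZMod p) :=
  univ.filter fun g => ∃ x, (g, x) ∈ l ∧ B x = i

open Classical in
/-- signs whose class contains a transversal `k`-set of color `j` -/
noncomputable def co [NeZero p] (B : ℕ → ℕ) (k : ℕ) (c : Finset ℕ → ℕ) (l : List (Vx p)) (j : ℕ) :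
    Finset (ZMod p) :=
  univ.filter fun g => ∃ A : Finset ℕ, (∀ x ∈ A, (g, x) ∈ l) ∧ #A = k ∧ Set.InjOn B A ∧ c A = j

lemma mem_map_sh (l : List (Vx p)) (a g : ZMod p) (x : ℕ) :
    (g, x) ∈ l.map (sh a) ↔ (g - a, x) ∈ l := by
  rw [List.mem_map]
  constructor
  · rintro ⟨⟨h, y⟩, hv, he⟩
    simp only [sh, Prod.mk.injEq] at he
    obtain ⟨rfl, rfl⟩ := he
    simpa using hv
  · intro h
    exact ⟨_, h, by simp [sh]⟩

lemma sg_shift [NeZero p] (B : ℕ → ℕ) (l : List (Vx p)) (i : ℕ) (a : ZMod p) :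
    Shifted a (sg B l i) (sg B (l.map (sh a)) i) := by
  intro g
  simp [sg, mem_map_sh]

lemma co_shift [NeZero p] (B : ℕ → ℕ) (k : ℕ) (c : Finset ℕ → ℕ) (l : List (Vx p)) (i : ℕ)
    (a : ZMod p) : Shifted a (co B k c l i) (co B k c (l.map (sh a)) i) := by
  intro g
  simp [co, mem_map_sh]

lemma sg_mono [NeZero p] (B : ℕ → ℕ) {l l' : List (Vx p)} (h : l'.Sublist l) (i : ℕ) :
    sg B l' i ⊆ sg B l i := by
  intro g
  simp only [sg, mem_filter, mem_univ, true_and]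
  rintro ⟨x, hx, hB⟩
  exact ⟨x, h.subset hx, hB⟩

lemma co_mono [NeZero p] (B : ℕ → ℕ) (k : ℕ) (c : Finset ℕ → ℕ) {l l' : List (Vx p)}
    (h : l'.Sublist l) (i : ℕ) : co B k c l' i ⊆ co B k c l i := by
  intro g
  simp only [co, mem_filter, mem_univ, true_and]
  rintro ⟨A, hA, h'⟩
  exact ⟨A, fun x hx => h.subset (hA x hx), h'⟩

lemma Good.uniq {m : ℕ} {l : List (Vx p)} (h : Good m l) {u v : Vx p} (hu : u ∈ l) (hv : v ∈ l)
    (huv : u.2 = v.2) : u = v := by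
  by_contra hne
  have h1 := h.1
  unfold Strict at h1
  have h2 : l.Pairwise fun u v => u.2 ≠ v.2 := h1.imp (fun h => h.ne')
  have : Std.Symm (fun u v : Vx p => u.2 ≠ v.2) := ⟨fun _ _ h => Ne.symm h⟩
  exact (h2.forall hu hv hne) huv

lemma Good.nodup {m : ℕ} {l : List (Vx p)} (h : Good m l) : l.Nodup := by
  have h1 := h.1
  unfold Strict at h1
  exact h1.imp (fun {u v} h e => by subst e; exact lt_irrefl _ h)

/-- If all blocks have size at most `p` and each block sees no or all signs, then the length of the
list is the total number of signs. -/
lemma length_eq [NeZero p] {N : ℕ} (B : ℕ → ℕ) (hB : ∀ i, #((range N).filter (B · = i)) ≤ p)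
    {l : List (Vx p)} (hl : Good N l) (hn : ∀ i, ¬ Nontriv (sg B l i)) :
    l.length = ∑ i ∈ (range N).image B, #(sg B l i) := by
  classical
  rw [← List.toFinset_card_of_nodup hl.nodup]
  rw [card_eq_sum_card_fiberwise (f := fun v : Vx p => B v.2) (t := (range N).image B)]
  · refine sum_congr rfl fun i hi => ?_
    have himg : sg B l i = (l.toFinset.filter fun v => B v.2 = i).image Prod.fst := by
      ext g
      simp [sg]
    apply le_antisymm
    · by_cases h0 : sg B l i = ∅
      · rw [himg, image_eq_empty] at h0
        rw [h0]; simp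
      · have h1 : sg B l i = univ := by
          by_contra h1
          exact hn i ⟨nonempty_iff_ne_empty.2 h0, h1⟩
        rw [h1, card_univ, ZMod.card]
        refine le_trans ?_ (hB i)
        refine card_le_card_of_injOn Prod.snd ?_ ?_
        · intro v hv
          simp only [coe_filter, List.mem_toFinset, Set.mem_ofPred_eq, mem_range] at hv ⊢
          exact ⟨hl.2 v hv.1, hv.2⟩
        · intro u hu v hv huv
          simp only [coe_filter, List.mem_toFinset, Set.mem_ofPred_eq] at hu hv
          exact hl.uniq hu.1 hv.1 huv
    · rw [himg]; exact card_image_le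
  · intro v hv
    simp only [List.coe_toFinset, Set.mem_ofPred_eq] at hv
    exact mem_coe.2 (mem_image_of_mem B (mem_range.2 (hl.2 v hv)))

lemma exists_trans [NeZero p] {N : ℕ} (B : ℕ → ℕ) (k : ℕ) (hk : 1 ≤ k) (l : List (Vx p))
    (h : p * (k - 1) < ∑ i ∈ (range N).image B, #(sg B l i)) :
    ∃ g, ∃ A : Finset ℕ, (∀ x ∈ A, (g, x) ∈ l) ∧ #A = k ∧ Set.InjOn B A := by
  classical
  set I := (range N).image B
  have h1 : ∑ i ∈ I, #(sg B l i) = ∑ g : ZMod p, #(I.filter fun i => g ∈ sg B l i) := by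
    simp only [card_eq_sum_ones]
    have : ∀ i, #(sg B l i) = ∑ g : ZMod p, if g ∈ sg B l i then 1 else 0 := by
      intro i; simp
    simp only [← card_eq_sum_ones, this]
    rw [sum_comm]
    simp
  have h2 : ∃ g : ZMod p, k - 1 < #(I.filter fun i => g ∈ sg B l i) := by
    by_contra! hcon
    have := sum_le_sum (fun g (_ : g ∈ (univ : Finset (ZMod p))) => hcon g)
    rw [← h1] at this
    simp [ZMod.card] at this
    omega
  obtain ⟨g, hg⟩ := h2
  obtain ⟨J, hJ, hJk⟩ := exists_subset_card_eq (show k ≤ _ by omega : k ≤ #(I.filter fun i => g ∈ sg B l i))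
  have h3 : ∀ i ∈ J, ∃ x, (g, x) ∈ l ∧ B x = i := by
    intro i hi
    have := (mem_filter.1 (hJ hi)).2
    simpa [sg] using this
  choose! x hx hxB using h3
  refine ⟨g, J.image x, ?_, ?_, ?_⟩
  · intro y hy
    obtain ⟨i, hi, rfl⟩ := mem_image.1 hy
    exact hx i hi
  · rw [card_image_of_injOn, hJk]
    intro i hi j hj hij
    rw [← hxB i hi, ← hxB j hj, hij]
  · intro y hy z hz hyz
    obtain ⟨i, hi, rfl⟩ := mem_image.1 (mem_coe.1 hy)
    obtain ⟨j, hj, rfl⟩ := mem_image.1 (mem_coe.1 hz)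
    rw [hxB i hi, hxB j hj] at hyz
    rw [hyz]

open Classical in
noncomputable def FF [Fact p.Prime] (N : ℕ) (B : ℕ → ℕ) (k m : ℕ) (c : Finset ℕ → ℕ)
    (l : List (Vx p)) : Vx p :=
  if ∑ i ∈ (range N).image B, #(sg B l i) ≤ p * (k - 1) then
    (if ∃ i, Nontriv (sg B l i) then pick (sg B l) else (l.head?.getD (0, 0)).1,
      ∑ i ∈ (range N).image B, #(sg B l i) - 1)
  else (pick (co B k c l), p * (k - 1) + ∑ j ∈ range m, #(co B k c l j) - 1)

theorem prime_range (hp : p.Prime) (B : ℕ → ℕ) (k m : ℕ) (c : Finset ℕ → ℕ) (hk : 1 ≤ k)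
    (hc : ∀ A, c A < m)
    (hB : ∀ i, #((range (m * (p - 1) + p * (k - 1) + 1)).filter (B · = i)) ≤ p) :
    ∃ A : ZMod p → Finset ℕ, (∀ j, A j ⊆ range (m * (p - 1) + p * (k - 1) + 1) ∧ #(A j) = k ∧
      Set.InjOn B (A j)) ∧ (∀ j j', j ≠ j' → Disjoint (A j) (A j')) ∧
      ∀ j j', c (A j) = c (A j') := by
  classical
  have : Fact p.Prime := ⟨hp⟩
  by_contra hno
  set M := m * (p - 1) + p * (k - 1) with hMdef
  set I := (range (M + 1)).image B with hI
  have hco : ∀ (l : List (Vx p)), Good (M+1) l → ∀ j, co B k c l j ≠ univ := by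
    intro l hl j hj
    apply hno
    have : ∀ g : ZMod p, ∃ A : Finset ℕ,
        (∀ x ∈ A, (g, x) ∈ l) ∧ #A = k ∧ Set.InjOn B A ∧ c A = j := by
      intro g
      have : g ∈ co B k c l j := by rw [hj]; exact mem_univ g
      simpa [co] using this
    choose A h1 h2 h3 h4 using this
    refine ⟨A, fun g => ⟨?_, h2 g, h3 g⟩, ?_, fun g g' => by rw [h4, h4]⟩
    · intro x hx
      exact mem_range.2 (hl.2 _ (h1 g x hx))
    · intro g g' hgg
      rw [Finset.disjoint_left]
      intro x hx hx'
      have := hl.uniq (h1 g x hx) (h1 g' x hx') rfl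
      simp at this
      exact hgg this
  have hcop : ∀ (l : List (Vx p)), Good (M+1) l → ∀ j, #(co B k c l j) ≤ p - 1 := by
    intro l hl j
    have h1 : #(co B k c l j) ≠ p := by
      intro h
      apply hco l hl j
      rw [← card_eq_iff_eq_univ, ZMod.card, h]
    have h2 := card_le_univ (co B k c l j)
    rw [ZMod.card] at h2
    omega
  have hcoe : ∀ (l : List (Vx p)) j, j ∉ range m → co B k c l j = ∅ := by
    intro l j hj
    rw [eq_empty_iff_forall_notMem]
    intro g hg
    simp only [co, mem_filter, mem_univ, true_and] at hg
    obtain ⟨A, _, _, _, h⟩ := hg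
    exact hj (mem_range.2 (h ▸ hc A))
  have hsge : ∀ (l : List (Vx p)), Good (M+1) l → ∀ j, j ∉ I → sg B l j = ∅ := by
    intro l hl j hj
    rw [eq_empty_iff_forall_notMem]
    intro g hg
    simp only [sg, mem_filter, mem_univ, true_and] at hg
    obtain ⟨x, hx, h⟩ := hg
    exact hj (h ▸ mem_image_of_mem B (mem_range.2 (hl.2 _ hx)))
  have hnt : ∀ (l : List (Vx p)), Good (M+1) l → ¬ ∑ i ∈ I, #(sg B l i) ≤ p * (k - 1) →
      ∃ j ∈ range m, 0 < #(co B k c l j) := by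
    intro l hl h
    obtain ⟨g, A, h1, h2, h3⟩ := exists_trans (N := M + 1) B k hk l (not_le.1 h)
    refine ⟨c A, mem_range.2 (hc A), card_pos.2 ⟨g, ?_⟩⟩
    simp only [co, mem_filter, mem_univ, true_and]
    exact ⟨A, h1, h2, h3, rfl⟩
  have hnt' : ∀ (l : List (Vx p)), Good (M+1) l → ¬ ∑ i ∈ I, #(sg B l i) ≤ p * (k - 1) →
      0 < ∑ j ∈ range m, #(co B k c l j) := by
    intro l hl h
    obtain ⟨j, hj, h0⟩ := hnt l hl h
    exact lt_of_lt_of_le h0 (single_le_sum (f := fun j => #(co B k c l j)) (by simp) hj)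
  have hpos : ∀ (l : List (Vx p)), Good (M+1) l → l ≠ [] → 0 < ∑ i ∈ I, #(sg B l i) := by
    intro l hl hne
    obtain ⟨v, l', rfl⟩ := List.exists_cons_of_ne_nil hne
    have h0 : 0 < #(sg B (v :: l') (B v.2)) := by
      refine card_pos.2 ⟨v.1, ?_⟩
      simp only [sg, mem_filter, mem_univ, true_and]
      exact ⟨v.2, by simp, rfl⟩
    exact lt_of_lt_of_le h0 (single_le_sum (f := fun j => #(sg B (v :: l') j)) (by simp)
      (mem_image_of_mem B (mem_range.2 (hl.2 v (by simp)))))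
  have hp2 := hp.two_le
  refine tucker M (FF (p := p) (M + 1) B k m c) hp2 ?_ ?_ ?_
  · intro l hl hne
    have h0 := hpos l hl hne
    by_cases h : ∑ i ∈ I, #(sg B l i) ≤ p * (k - 1)
    · have e : FF (M+1) B k m c l = (if ∃ i, Nontriv (sg B l i) then pick (sg B l) else
          (l.head?.getD (0, 0)).1, ∑ i ∈ I, #(sg B l i) - 1) := if_pos h
      rw [e]
      show ∑ i ∈ I, #(sg B l i) - 1 < M
      omega
    · have e : FF (M+1) B k m c l =
          (pick (co B k c l), p * (k - 1) + ∑ j ∈ range m, #(co B k c l j) - 1) := if_neg h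
      rw [e]
      have h1 := hnt' l hl h
      have h2 : ∑ j ∈ range m, #(co B k c l j) ≤ m * (p - 1) := by
        have := sum_le_sum (fun j (_ : j ∈ range m) => hcop l hl j)
        simpa using this
      show _ - 1 < M
      omega
  · intro l a hl hne
    have e1 : ∀ i, #(sg B (l.map (sh a)) i) = #(sg B l i) := fun i => (sg_shift B l i a).card
    have e2 : ∀ i, #(co B k c (l.map (sh a)) i) = #(co B k c l i) :=
      fun i => (co_shift B k c l i a).card
    have e3 : ∀ i, Nontriv (sg B (l.map (sh a)) i) ↔ Nontriv (sg B l i) :=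
      fun i => (sg_shift B l i a).nontriv
    unfold FF
    simp only [e1, e2, e3]
    split_ifs with h h'
    · simp only [sh, Prod.mk.injEq, and_true]
      exact pick_shift (fun i => sg_shift B l i a) h'
    · obtain ⟨v, l', rfl⟩ := List.exists_cons_of_ne_nil hne
      simp [sh]
    · simp only [sh, Prod.mk.injEq, and_true]
      refine pick_shift (fun i => co_shift B k c l i a) ?_
      obtain ⟨j, _, hj⟩ := hnt l hl h
      exact ⟨j, card_pos.1 hj, hco l hl j⟩
  · intro l l' hl hsub hne'
    have hl' := hl.sub hsub
    have hne : l ≠ [] := by rintro rfl; exact hne' (List.sublist_nil.1 hsub)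
    have h0 := hpos l hl hne
    have h0' := hpos l' hl' hne'
    have hle : ∑ i ∈ I, #(sg B l' i) ≤ ∑ i ∈ I, #(sg B l i) :=
      sum_le_sum fun i _ => card_le_card (sg_mono B hsub i)
    have hle2 : ∑ i ∈ range m, #(co B k c l' i) ≤ ∑ i ∈ range m, #(co B k c l i) :=
      sum_le_sum fun i _ => card_le_card (co_mono B k c hsub i)
    by_cases h : ∑ i ∈ I, #(sg B l i) ≤ p * (k - 1)
    · have h' := hle.trans h
      have e : FF (M+1) B k m c l = (if ∃ i, Nontriv (sg B l i) then pick (sg B l) else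
          (l.head?.getD (0, 0)).1, ∑ i ∈ I, #(sg B l i) - 1) := if_pos h
      have e' : FF (M+1) B k m c l' = (if ∃ i, Nontriv (sg B l' i) then pick (sg B l') else
          (l'.head?.getD (0, 0)).1, ∑ i ∈ I, #(sg B l' i) - 1) := if_pos h'
      rcases hle.lt_or_eq with hlt | heq
      · left
        rw [e, e']
        show _ - 1 < _ - 1
        omega
      · right
        have hT : sg B l' = sg B l := fam_eq I (sg_mono B hsub) (hsge l hl) heq.ge
        by_cases hN : ∃ i, Nontriv (sg B l i)
        · rw [e, e', hT, if_pos hN, if_pos hN]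
        · have : l' = l := by
            apply hsub.eq_of_length
            have hN' := not_exists.1 hN
            rw [length_eq B hB hl hN', length_eq B hB hl' (by rw [hT]; exact hN')]
            exact heq
          rw [this]
    · have e : FF (M+1) B k m c l =
          (pick (co B k c l), p * (k - 1) + ∑ j ∈ range m, #(co B k c l j) - 1) := if_neg h
      have hq := hnt' l hl h
      by_cases h' : ∑ i ∈ I, #(sg B l' i) ≤ p * (k - 1)
      · left
        have e' : FF (M+1) B k m c l' = (if ∃ i, Nontriv (sg B l' i) then pick (sg B l') else
          (l'.head?.getD (0, 0)).1, ∑ i ∈ I, #(sg B l' i) - 1) := if_pos h'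
        rw [e, e']
        show _ - 1 < _ - 1
        omega
      · have e' : FF (M+1) B k m c l' =
          (pick (co B k c l'), p * (k - 1) + ∑ j ∈ range m, #(co B k c l' j) - 1) := if_neg h'
        have hq' := hnt' l' hl' h'
        rcases hle2.lt_or_eq with hlt | heq
        · left
          rw [e, e']
          show _ - 1 < _ - 1
          omega
        · right
          have hT : co B k c l' = co B k c l :=
            fam_eq (range m) (co_mono B k c hsub) (hcoe l) heq.ge
          rw [e, e', hT]

end ZT

namespace ZT

/-- The partition version for `r` sets and blocks of size at most `b`. -/
def PS (r b : ℕ) : Prop :=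
  ∀ (G : Finset ℕ) (B : ℕ → ℕ) (k m : ℕ) (c : Finset ℕ → ℕ), 1 ≤ k → (∀ A, c A < m) →
    (∀ i, #(G.filter (B · = i)) ≤ b) → m * (r - 1) + r * (k - 1) < #G →
    ∃ A : Fin r → Finset ℕ, (∀ j, A j ⊆ G ∧ #(A j) = k ∧ Set.InjOn B (A j)) ∧
      (∀ j j', j ≠ j' → Disjoint (A j) (A j')) ∧ ∀ j j', c (A j) = c (A j')

lemma PS_prime {p : ℕ} (hp : p.Prime) : PS p p := by
  classical
  intro G B k m c hk hc hB hG
  have : Fact p.Prime := ⟨hp⟩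
  set M := m * (p - 1) + p * (k - 1) with hM
  obtain ⟨G', hG', hcard⟩ := exists_subset_card_eq (show M + 1 ≤ #G by omega)
  let e : ℕ → ℕ := fun i => if h : i < M + 1 then G'.orderEmbOfFin hcard ⟨i, h⟩ else 0
  have heG : ∀ i ∈ range (M + 1), e i ∈ G' := by
    intro i hi
    simp only [e, dif_pos (mem_range.1 hi)]
    exact orderEmbOfFin_mem _ _ _
  have hinj : Set.InjOn e (range (M + 1) : Finset ℕ) := by
    intro i hi j hj hij
    have hi' := mem_range.1 (mem_coe.1 hi)
    have hj' := mem_range.1 (mem_coe.1 hj)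
    simp only [e, dif_pos hi', dif_pos hj'] at hij
    have := (G'.orderEmbOfFin hcard).injective hij
    simpa using this
  obtain ⟨A, h1, h2, h3⟩ := prime_range hp (B ∘ e) k m (fun A => c (A.image e)) hk
    (fun A => hc _) (by
      intro i
      refine le_trans ?_ (hB i)
      refine card_le_card_of_injOn e ?_ ?_
      · intro x hx
        simp only [coe_filter, Set.mem_ofPred_eq, Function.comp] at hx ⊢
        exact ⟨hG' (heG x hx.1), hx.2⟩
      · intro x hx y hy
        simp only [coe_filter, Set.mem_ofPred_eq] at hx hy
        exact hinj hx.1 hy.1)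
  have hcardZ : Fintype.card (ZMod p) = p := ZMod.card p
  let φ := (Fintype.equivFinOfCardEq hcardZ).symm
  refine ⟨fun j => (A (φ j)).image e, ?_, ?_, ?_⟩
  · intro j
    obtain ⟨ha, hb, hd⟩ := h1 (φ j)
    refine ⟨?_, ?_, ?_⟩
    · intro y hy
      obtain ⟨x, hx, rfl⟩ := mem_image.1 hy
      exact hG' (heG x (ha hx))
    · rw [card_image_of_injOn (hinj.mono (by exact_mod_cast ha)), hb]
    · intro y hy z hz hyz
      obtain ⟨x, hx, rfl⟩ := mem_image.1 (mem_coe.1 hy)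
      obtain ⟨w, hw, rfl⟩ := mem_image.1 (mem_coe.1 hz)
      rw [hd hx hw hyz]
  · intro j j' hjj
    have hd := h2 (φ j) (φ j') (fun h => hjj (φ.injective h))
    rw [Finset.disjoint_left] at hd ⊢
    intro y hy hy'
    obtain ⟨x, hx, rfl⟩ := mem_image.1 hy
    obtain ⟨w, hw, hwx⟩ := mem_image.1 hy'
    have := hinj ((h1 _).1 hw) ((h1 _).1 hx) hwx
    subst this
    exact hd hx hw
  · intro j j'
    exact h3 _ _

lemma PS_one : PS 1 1 := by
  intro G B k m c hk hc hB hG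
  obtain ⟨A, hA, hAk⟩ := exists_subset_card_eq (show k ≤ #G by omega)
  refine ⟨fun _ => A, fun _ => ⟨hA, hAk, ?_⟩, ?_, fun _ _ => rfl⟩
  · intro x hx y hy hxy
    exact card_le_one.1 (hB (B y)) x (mem_filter.2 ⟨hA hx, hxy⟩) y (mem_filter.2 ⟨hA hy, rfl⟩)
  · intro j j' h
    exact absurd (Subsingleton.elim j j') h

lemma PS_mul {r₁ r₂ b₁ b₂ : ℕ} (hr₁ : 1 ≤ r₁) (hr₂ : 1 ≤ r₂) (hb₁ : 1 ≤ b₁) (h₁ : PS r₁ b₁)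
    (h₂ : PS r₂ b₂) : PS (r₁ * r₂) (b₁ * b₂) := by
  classical
  intro G B k m c hk hc hB hG
  set k' := m * (r₂ - 1) + r₂ * (k - 1) + 1 with hk'
  let ρ : ℕ → ℕ := fun x => #(G.filter fun y => B y = B x ∧ y < x)
  have hρ : ∀ x ∈ G, ρ x < b₁ * b₂ := by
    intro x hx
    refine lt_of_lt_of_le ?_ (hB (B x))
    refine card_lt_card ⟨?_, ?_⟩
    · intro y hy
      simp only [mem_filter] at hy ⊢
      exact ⟨hy.1, hy.2.1⟩
    · intro h
      have := h (show x ∈ G.filter (B · = B x) by simp [hx])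
      simp at this
  have hρlt : ∀ x ∈ G, ∀ y ∈ G, B x = B y → x < y → ρ x < ρ y := by
    intro x hx y hy hB hxy
    refine card_lt_card ⟨?_, ?_⟩
    · intro z hz
      simp only [mem_filter] at hz ⊢
      exact ⟨hz.1, hz.2.1.trans hB, hz.2.2.trans hxy⟩
    · intro h
      have := h (show x ∈ G.filter (fun z => B z = B y ∧ z < y) by simp [hx, hB, hxy])
      simp at this
  have hρinj : ∀ x ∈ G, ∀ y ∈ G, B x = B y → ρ x = ρ y → x = y := by
    intro x hx y hy hB h
    rcases lt_trichotomy x y with h' | h' | h'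
    · exact absurd (hρlt x hx y hy hB h') (by omega)
    · exact h'
    · exact absurd (hρlt y hy x hx hB.symm h') (by omega)
  let Q : ℕ → ℕ := fun x => Nat.pair (B x) (ρ x / b₁)
  let good : Finset ℕ → ℕ → (Fin r₂ → Finset ℕ) → Prop := fun Y col A =>
    (∀ j, A j ⊆ Y ∧ #(A j) = k ∧ Set.InjOn B (A j)) ∧
      (∀ j j', j ≠ j' → Disjoint (A j) (A j')) ∧ ∀ j, c (A j) = col
  let c' : Finset ℕ → ℕ := fun Y =>
    if h : ∃ col, col < m ∧ ∃ A, good Y col A then h.choose else c ∅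
  have hc' : ∀ Y, c' Y < m := by
    intro Y
    simp only [c']
    split_ifs with h
    · exact h.choose_spec.1
    · exact hc _
  have hin : ∀ Y ⊆ G, #Y = k' → Set.InjOn Q Y → ∃ A, good Y (c' Y) A := by
    intro Y hY hYk hQ
    have hex : ∃ col, col < m ∧ ∃ A, good Y col A := by
      obtain ⟨A, ha, hb, hd⟩ := h₂ Y B k m c hk hc (by
        intro i
        have : #(range b₂) = b₂ := card_range _
        rw [← this]
        refine card_le_card_of_injOn (fun x => ρ x / b₁) ?_ ?_
        · intro x hx
          simp only [coe_filter, Set.mem_ofPred_eq] at hx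
          simp only [coe_range, Set.mem_Iio]
          exact Nat.div_lt_of_lt_mul (hρ x (hY hx.1))
        · intro x hx y hy hxy
          simp only [coe_filter, Set.mem_ofPred_eq] at hx hy
          apply hQ hx.1 hy.1
          simp only [Q]
          simp only at hxy
          rw [hx.2, hy.2, hxy]) (by omega)
      exact ⟨c (A ⟨0, hr₂⟩), hc _, A, ha, hb, fun j => hd _ _⟩
    have e : c' Y = hex.choose := dif_pos hex
    rw [e]
    exact hex.choose_spec.2
  obtain ⟨Y, hY1, hY2, hY3⟩ := h₁ G Q k' m c' (by omega) hc' (by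
    intro i
    have : #(Ico (b₁ * (Nat.unpair i).2) (b₁ * (Nat.unpair i).2 + b₁)) = b₁ := by simp
    rw [← this]
    refine card_le_card_of_injOn ρ ?_ ?_
    · intro x hx
      simp only [coe_filter, Set.mem_ofPred_eq] at hx
      simp only [coe_Ico, Set.mem_Ico]
      rw [← hx.2]
      simp only [Q, Nat.unpair_pair]
      have := Nat.div_add_mod (ρ x) b₁
      have := Nat.mod_lt (ρ x) hb₁
      omega
    · intro x hx y hy hxy
      simp only [coe_filter, Set.mem_ofPred_eq] at hx hy
      refine hρinj x hx.1 y hy.1 ?_ hxy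
      have := hx.2.trans hy.2.symm
      exact (Nat.pair_eq_pair.1 this).1) (by
    refine lt_of_le_of_lt (le_of_eq ?_) hG
    obtain ⟨a, rfl⟩ := Nat.exists_eq_add_of_le hr₁
    obtain ⟨b, rfl⟩ := Nat.exists_eq_add_of_le hr₂
    have e : (1 + a) * (1 + b) - 1 = a + b + a * b := by
      have : (1 + a) * (1 + b) = 1 + (a + b + a * b) := by ring
      omega
    rw [hk', e]
    simp only [Nat.add_sub_cancel_left, Nat.add_sub_cancel]
    ring)
  have := fun j => hin (Y j) (hY1 j).1 (hY1 j).2.1 (hY1 j).2.2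
  choose A hA1 hA2 hA3 using this
  let ψ := (finProdFinEquiv (m := r₁) (n := r₂)).symm
  refine ⟨fun i => A (ψ i).1 (ψ i).2, ?_, ?_, ?_⟩
  · intro i
    obtain ⟨ha, hb, hd⟩ := hA1 (ψ i).1 (ψ i).2
    exact ⟨ha.trans (hY1 _).1, hb, hd⟩
  · intro i j hij
    have hne : ψ i ≠ ψ j := fun h => hij (ψ.injective h)
    by_cases h : (ψ i).1 = (ψ j).1
    · have h' : (ψ i).2 ≠ (ψ j).2 := fun h' => hne (Prod.ext h h')
      show Disjoint (A (ψ i).1 (ψ i).2) (A (ψ j).1 (ψ j).2)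
      rw [h]
      exact hA2 _ _ _ h'
    · exact (hY2 _ _ h).mono (hA1 _ _).1 (hA1 _ _).1
  · intro i j
    show c (A (ψ i).1 (ψ i).2) = c (A (ψ j).1 (ψ j).2)
    rw [hA3, hA3]
    exact hY3 _ _

lemma PS_all (r : ℕ) : r ≠ 0 → PS r r := by
  induction r using induction_on_primes with
  | zero => intro h; exact absurd rfl h
  | one => intro _; exact PS_one
  | prime_mul p a hp ih =>
    intro h
    have ha : a ≠ 0 := by rintro rfl; simp at h
    exact PS_mul hp.one_le (Nat.pos_of_ne_zero ha) hp.one_le (PS_prime hp) (ih ha)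

lemma bfun_le (r : ℕ) (hr : r ≠ 0) : bfun r ≤ r := by
  conv_rhs => rw [← Nat.prod_factorization_pow_eq_self hr]
  unfold bfun Finsupp.prod
  refine prod_le_prod' fun q _ => ?_
  refine Nat.pow_le_pow_left ?_ _
  split_ifs with h
  · omega
  · omega

end ZT

/-- the generalized Erdős–Kneser theorem.  Any coloring of the `k`-subsets of
`[n]` with fewer than `⌈((s-1)n - r(k-1))/(r-1)⌉` colors yields `r` `k`-subsets of the same
color such that any `s` of them (with multiplicity) have empty common intersection. -/
theorem stmt2 (r s k n m : ℕ) (hr : 2 ≤ r) (hk : 1 ≤ k) (hs : 2 ≤ s) (hsb : s ≤ bfun r)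
    (hn : s * k ≤ n)
    (hm : m < cld ((s - 1) * n - r * (k - 1)) (r - 1))
    (c : Finset (Fin n) → Fin m) :
    ∃ A : Fin r → Finset (Fin n), (∀ j, (A j).card = k) ∧
      (∀ j j', c (A j) = c (A j')) ∧
      ∀ I : Finset (Fin r), I.card = s → I.inf A = ∅ := by
  classical
  have hsr : s ≤ r := hsb.trans (ZT.bfun_le r (by omega))
  obtain ⟨S, rfl⟩ : ∃ S, s = S + 1 := ⟨s - 1, by omega⟩
  simp only [Nat.add_sub_cancel] at hm
  have hSpos : 0 < S := by omega
  have hn0 : 0 < n := lt_of_lt_of_le (Nat.mul_pos (by omega) (by omega)) hn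
  have hG : m * (r - 1) + r * (k - 1) < S * n := by
    unfold cld at hm
    have h1 := (Nat.le_div_iff_mul_le (show 0 < r - 1 by omega)).1 (Nat.succ_le_of_lt hm)
    rw [Nat.succ_mul] at h1
    omega
  let f : ℕ → Fin n := fun x => if h : x / S < n then ⟨x / S, h⟩ else ⟨0, hn0⟩
  have hf : ∀ x ∈ range (S * n), (f x).val = x / S := by
    intro x hx
    have : x / S < n := Nat.div_lt_of_lt_mul (mem_range.1 hx)
    simp [f, this]
  have hfib : ∀ i, #((range (S * n)).filter (fun x => x / S = i)) ≤ S := by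
    intro i
    have : #(Ico (S * i) (S * i + S)) = S := by simp
    refine le_trans (card_le_card ?_) this.le
    intro x hx
    have h2 := (mem_filter.1 hx).2
    rw [mem_Ico]
    have := Nat.div_add_mod x S
    have := Nat.mod_lt x hSpos
    rw [h2] at *
    omega
  obtain ⟨A, h1, h2, h3⟩ := ZT.PS_all r (by omega) (range (S * n)) (fun x => x / S) k m
    (fun X => (c (X.image f)).val) hk (fun X => (c _).isLt)
    (fun i => (hfib i).trans (by omega)) (by simpa using hG)
  refine ⟨fun j => (A j).image f, ?_, ?_, ?_⟩
  · intro j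
    obtain ⟨ha, hb, hd⟩ := h1 j
    rw [card_image_of_injOn, hb]
    intro x hx y hy hxy
    apply hd hx hy
    show x / S = y / S
    rw [← hf x (ha hx), ← hf y (ha hy), hxy]
  · intro j j'
    exact Fin.ext (h3 j j')
  · intro I hI
    rw [eq_empty_iff_forall_notMem]
    intro i hi
    have hmem : ∀ j ∈ I, ∃ x ∈ A j, f x = i := by
      intro j hj
      have hle : I.inf (fun j => (A j).image f) ≤ (A j).image f := inf_le hj
      exact mem_image.1 (hle hi)
    choose! x hx hxi using hmem
    have hcard : #I ≤ #((range (S * n)).filter (fun x => x / S = i.val)) := by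
      refine card_le_card_of_injOn x ?_ ?_
      · intro j hj
        have hm := (h1 j).1 (hx j hj)
        refine mem_coe.2 (mem_filter.2 ⟨hm, ?_⟩)
        rw [← hf _ hm, hxi j hj]
      · intro j hj j' hj' hjj
        by_contra hne
        have hd := h2 j j' hne
        rw [Finset.disjoint_left] at hd
        exact hd (hx j hj) (hjj ▸ hx j' hj')
    have := hfib i.val
    omega
end

section
/- Let r ≥ 2 be an integer and b(r) as defined. Let k ≥ 1, n ≥ 1, and s = (s_1,...,s_n) with s_i ∈ {1,...,b(r)-1}. Then χ(KG^r_s(n,k)) ≥ ⌈((Σ_i s_i) - r(k-1))/(r-1)⌉. -/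
open Finset

section Cochains

/-- Augmented coboundary of a function on lists. -/
def dl {α R : Type*} [CommRing R] : (List α → R) → List α → R
  | _, [] => 0
  | φ, a :: l => φ l - dl (fun l' => φ (a :: l')) l

theorem dl_sub {α R : Type*} [CommRing R] (l : List α) (φ ψ : List α → R) :
    dl (fun x => φ x - ψ x) l = dl φ l - dl ψ l := by
  induction l generalizing φ ψ with
  | nil => simp [dl]
  | cons a l ih => simp only [dl]; rw [ih]; ring

theorem dl_zero {α R : Type*} [CommRing R] (l : List α) :
    dl (fun _ => (0 : R)) l = 0 := by
  induction l with
  | nil => simp [dl]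
  | cons a l ih => simp only [dl]; rw [ih]; ring

theorem dl_sum {α R β : Type*} [CommRing R] (l : List α) (s : Finset β) (φ : β → List α → R) :
    dl (fun x => ∑ t ∈ s, φ t x) l = ∑ t ∈ s, dl (φ t) l := by
  induction l generalizing φ with
  | nil => simp [dl]
  | cons a l ih => simp only [dl]; rw [ih, ← Finset.sum_sub_distrib]

theorem dl_dl {α R : Type*} [CommRing R] (l : List α) (φ : List α → R) :
    dl (dl φ) l = 0 := by
  induction l generalizing φ with
  | nil => simp [dl]
  | cons a l ih =>
    simp only [dl]
    rw [dl_sub, ih]; ring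

theorem dl_map {α β R : Type*} [CommRing R] (f : α → β) (l : List α) (φ : List β → R) :
    dl φ (l.map f) = dl (fun l' => φ (l'.map f)) l := by
  induction l generalizing φ with
  | nil => simp [dl]
  | cons a l ih => simp only [dl, List.map_cons]; rw [ih]

theorem dl_congr {α R : Type*} [CommRing R] (l : List α) (φ ψ : List α → R)
    (h : ∀ l', l'.Sublist l → l'.length + 1 = l.length → φ l' = ψ l') : dl φ l = dl ψ l := by
  induction l generalizing φ ψ with
  | nil => simp [dl]
  | cons a l ih =>
    simp only [dl]
    rw [h l (List.sublist_cons_self a l) (by simp)]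
    rw [ih (fun l' => φ (a :: l')) (fun l' => ψ (a :: l'))]
    intro l' h1 h2
    exact h _ (h1.cons_cons a) (by simp [h2])

/-- list with two equal adjacent entries -/
def Deg {α : Type*} (l : List α) : Prop := ∃ l1 a l2, l = l1 ++ a :: a :: l2

theorem dl_deg {α R : Type*} [CommRing R] (φ : List α → R) (h : ∀ l, Deg l → φ l = 0)
    (l : List α) (hl : Deg l) : dl φ l = 0 := by
  obtain ⟨l1, a, l2, rfl⟩ := hl
  induction l1 generalizing φ with
  | nil =>
    simp only [List.nil_append, dl]
    have : (fun l' => φ (a :: a :: l')) = fun _ => 0 := by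
      funext l'; exact h _ ⟨[], a, l', rfl⟩
    rw [this, dl_zero]; ring
  | cons b l1 ih =>
    simp only [List.cons_append, dl]
    rw [h _ ⟨l1, a, l2, rfl⟩, ih]
    · ring
    · rintro _ ⟨m1, c, m2, rfl⟩
      exact h _ ⟨b :: m1, c, m2, rfl⟩

/-- The operators `g - 1` (even) and the norm (odd). -/
def nm {p : ℕ} [NeZero p] {α : Type*} (T : ZMod p → α → α) (d : ℕ) (ψ : α → ZMod p) (x : α) :
    ZMod p :=
  if Even d then ψ (T 1 x) - ψ x else ∑ t, ψ (T t x)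

theorem nm_nm {p : ℕ} [NeZero p] {α : Type*} (T : ZMod p → α → α)
    (hT : ∀ s t x, T s (T t x) = T (s + t) x) (d : ℕ) (ψ : α → ZMod p) (x : α) :
    nm T d (nm T (d + 1) ψ) x = 0 := by
  have key : ∀ x, ∑ t, ψ (T t (T 1 x)) = ∑ t, ψ (T t x) := by
    intro x
    simp_rw [hT]
    exact Fintype.sum_equiv (Equiv.addRight 1) _ _ (fun t => rfl)
  unfold nm
  by_cases hd : Even d
  · have : ¬ Even (d + 1) := by simpa [Nat.even_add_one] using hd
    simp only [hd, this, if_true, if_false]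
    rw [key]; ring
  · have : Even (d + 1) := by simpa [Nat.even_add_one] using hd
    simp only [hd, this, if_true, if_false]
    rw [Finset.sum_sub_distrib, sub_eq_zero]
    simp_rw [hT]
    exact Fintype.sum_equiv (Equiv.addLeft 1) _ _ (fun t => rfl)

theorem nm_dl {p : ℕ} [NeZero p] {α : Type*} (τ : ZMod p → α → α) (d : ℕ)
    (ψ : List α → ZMod p) (l : List α) :
    nm (fun t => List.map (τ t)) d (dl ψ) l = dl (nm (fun t => List.map (τ t)) d ψ) l := by
  unfold nm
  split_ifs with hd
  · rw [dl_map, dl_sub]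
  · simp_rw [dl_map]
    rw [dl_sum]

theorem nm_add_two {p : ℕ} [NeZero p] {α : Type*} (T : ZMod p → α → α) (d : ℕ)
    (ψ : α → ZMod p) : nm T (d + 2) ψ = nm T d ψ := by
  funext x
  unfold nm
  have : Even (d + 2) ↔ Even d := by simp [Nat.even_add]
  simp [this]

/-- Chain functionals. -/
def HH {p : ℕ} [NeZero p] : ℕ → (List (ZMod p × ℕ) → ZMod p) → ZMod p
  | 0, φ => φ [(0, 0)]
  | d + 1, φ => HH d (nm (fun t => List.map (fun v : ZMod p × ℕ => (v.1 + t, v.2))) d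
      (fun l => φ ((0, d + 1) :: l)))

/-- shift of lists of vertices -/
abbrev TV {p : ℕ} (t : ZMod p) : List (ZMod p × ℕ) → List (ZMod p × ℕ) :=
  List.map (fun v : ZMod p × ℕ => (v.1 + t, v.2))

/-- shift of lists of signs -/
abbrev TZ {p : ℕ} (t : ZMod p) : List (ZMod p) → List (ZMod p) :=
  List.map (fun v : ZMod p => v + t)

theorem TV_TV {p : ℕ} (s t : ZMod p) (x : List (ZMod p × ℕ)) : TV s (TV t x) = TV (s + t) x := by
  simp [TV, Function.comp_def, add_assoc, add_comm s t]

theorem TZ_TZ {p : ℕ} (s t : ZMod p) (x : List (ZMod p)) : TZ s (TZ t x) = TZ (s + t) x := by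
  simp [TZ, Function.comp_def, add_assoc, add_comm s t]

theorem HH_succ {p : ℕ} [NeZero p] (d : ℕ) (φ : List (ZMod p × ℕ) → ZMod p) :
    HH (d + 1) φ = HH d (nm TV d (fun l => φ ((0, d + 1) :: l))) := rfl

theorem nm_sub {p : ℕ} [NeZero p] {α : Type*} (T : ZMod p → α → α) (d : ℕ) (φ ψ : α → ZMod p) :
    nm T d (fun x => φ x - ψ x) = fun x => nm T d φ x - nm T d ψ x := by
  funext x
  unfold nm
  split_ifs
  · ring
  · rw [Finset.sum_sub_distrib]

theorem HH_sub {p : ℕ} [NeZero p] (d : ℕ) (φ ψ : List (ZMod p × ℕ) → ZMod p) :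
    HH d (fun x => φ x - ψ x) = HH d φ - HH d ψ := by
  induction d generalizing φ ψ with
  | zero => simp [HH]
  | succ d ih => rw [HH_succ, nm_sub, ih]; rfl

theorem HH_zero {p : ℕ} [NeZero p] (d : ℕ) :
    HH d (fun _ : List (ZMod p × ℕ) => (0 : ZMod p)) = 0 := by
  have := HH_sub d (fun _ : List (ZMod p × ℕ) => (0 : ZMod p)) (fun _ => 0)
  simpa using this

theorem HH_congr {p : ℕ} [NeZero p] (d : ℕ) (φ ψ : List (ZMod p × ℕ) → ZMod p)
    (h : ∀ l, l.map Prod.snd = (List.range (d + 1)).reverse → φ l = ψ l) : HH d φ = HH d ψ := by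
  induction d generalizing φ ψ with
  | zero => exact h _ (by simp)
  | succ d ih =>
    rw [HH_succ, HH_succ]
    apply ih
    intro l hl
    have key : ∀ t, φ ((0, d + 1) :: TV t l) = ψ ((0, d + 1) :: TV t l) := by
      intro t
      apply h
      rw [List.range_succ, List.reverse_append]
      simp only [List.map_cons, TV, List.map_map, Function.comp_def]
      simp [← hl]
    have key0 : φ ((0, d + 1) :: l) = ψ ((0, d + 1) :: l) := by simpa [TV] using key 0
    unfold nm
    split_ifs
    · show φ ((0, d + 1) :: TV 1 l) - φ ((0, d + 1) :: l) = _
      rw [key, key0]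
    · exact Finset.sum_congr rfl (fun t _ => key t)

theorem HH_dl {p : ℕ} [NeZero p] (d : ℕ) (ψ : List (ZMod p × ℕ) → ZMod p) :
    HH (d + 1) (dl ψ) = HH d (nm TV d ψ) := by
  have aux : ∀ d (ψ' : List (ZMod p × ℕ) → ZMod p), HH d (dl (nm TV d ψ')) = 0 → 
      ∀ ψ : List (ZMod p × ℕ) → ZMod p, (fun l => ψ ((0, d + 1) :: l)) = ψ' →
      HH (d + 1) (dl ψ) = HH d (nm TV d ψ) := by
    rintro d ψ' h0 ψ rfl
    rw [HH_succ]
    have : (fun l => dl ψ ((0, d + 1) :: l)) =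
        fun l => ψ l - dl (fun l' => ψ ((0, d + 1) :: l')) l := rfl
    rw [this, nm_sub, HH_sub]
    have h2 : nm TV d (dl (fun l' => ψ ((0, d + 1) :: l'))) =
        dl (nm TV d (fun l' => ψ ((0, d + 1) :: l'))) := by
      funext l; exact nm_dl _ d _ l
    rw [h2, h0, sub_zero]
  induction d generalizing ψ with
  | zero =>
    refine aux 0 _ ?_ ψ rfl
    simp [HH, dl, nm, TV]
  | succ d ih =>
    refine aux (d + 1) _ ?_ ψ rfl
    rw [ih]
    have : nm TV d (nm TV (d + 1) fun l => ψ ((0, d + 1 + 1) :: l)) = fun _ => 0 := by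
      funext l; exact nm_nm _ TV_TV d _ l
    rw [this, HH_zero]

/-- Barycentric subdivision (dual form). -/
def SS {α R : Type*} [DecidableEq α] [CommRing R] :
    ℕ → (List (Finset α) → R) → List α → R
  | 0, φ, _ => φ []
  | n + 1, φ, l => dl (SS n (fun l' => φ (l.toFinset :: l'))) l

theorem SS_sub {α R : Type*} [DecidableEq α] [CommRing R] (n : ℕ) (φ ψ : List (Finset α) → R)
    (l : List α) : SS n (fun x => φ x - ψ x) l = SS n φ l - SS n ψ l := by
  induction n generalizing φ ψ l with
  | zero => simp [SS]
  | succ n ih =>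
    simp only [SS]
    rw [← dl_sub]
    congr 1
    funext l'
    exact ih _ _ _

theorem SS_sum {α R β : Type*} [DecidableEq α] [CommRing R] (n : ℕ) (s : Finset β)
    (φ : β → List (Finset α) → R) (l : List α) :
    SS n (fun x => ∑ t ∈ s, φ t x) l = ∑ t ∈ s, SS n (φ t) l := by
  induction n generalizing φ l with
  | zero => simp [SS]
  | succ n ih =>
    simp only [SS]
    rw [← dl_sum]
    congr 1
    funext l'
    exact ih _ _

theorem SS_dl {α R : Type*} [DecidableEq α] [CommRing R] (n : ℕ) (φ : List (Finset α) → R)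
    (l : List α) (hl : l.length = n + 1) : SS (n + 1) (dl φ) l = dl (SS n φ) l := by
  induction n generalizing φ l with
  | zero =>
    simp only [SS]
    have : (fun _ : List α => dl φ [l.toFinset]) = fun _ => φ [] := by
      funext; simp [dl]
    rw [this]
  | succ n ih =>
    have h1 : SS (n + 1 + 1) (dl φ) l =
      dl (SS (n + 1) (fun l' => φ l' - dl (fun m => φ (l.toFinset :: m)) l')) l := rfl
    rw [h1]
    have h2 : SS (n + 1) (fun l' => φ l' - dl (fun m => φ (l.toFinset :: m)) l') =
      fun x => SS (n + 1) φ x - SS (n + 1) (dl (fun m => φ (l.toFinset :: m))) x := by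
      funext x; exact SS_sub _ _ _ _
    rw [h2, dl_sub]
    have h3 : dl (SS (n + 1) (dl (fun m => φ (l.toFinset :: m)))) l =
        dl (dl (SS n (fun m => φ (l.toFinset :: m)))) l := by
      apply dl_congr
      intro l' _ h
      exact ih _ _ (by omega)
    rw [h3, dl_dl, sub_zero]

theorem SS_congr {α R : Type*} [DecidableEq α] [CommRing R] (n : ℕ) (φ ψ : List (Finset α) → R)
    (l : List α) (hl : l.length = n) (hnd : l.Nodup)
    (h : ∀ m : List (Finset α), m.length = n → m.Pairwise (fun a b => b ⊂ a) →
      (∀ a ∈ m, a.Nonempty ∧ a ⊆ l.toFinset) → φ m = ψ m) : SS n φ l = SS n ψ l := by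
  induction n generalizing φ ψ l with
  | zero => exact h [] rfl List.Pairwise.nil (by simp)
  | succ n ih =>
    simp only [SS]
    apply dl_congr
    intro l' h1 h2
    apply ih _ _ _ (by omega) (hnd.sublist h1)
    intro m hm1 hm2 hm3
    have hss : l'.toFinset ⊂ l.toFinset := by
      refine Finset.ssubset_iff_subset_ne.2 ⟨?_, ?_⟩
      · intro a ha
        simp only [List.mem_toFinset] at ha ⊢
        exact h1.subset ha
      · intro he
        have := congrArg Finset.card he
        rw [List.toFinset_card_of_nodup hnd, List.toFinset_card_of_nodup (hnd.sublist h1)] at this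
        omega
    apply h
    · simp [hm1]
    · refine List.Pairwise.cons ?_ hm2
      intro a ha
      exact lt_of_le_of_lt (hm3 a ha).2 hss
    · intro a ha
      rcases List.mem_cons.1 ha with rfl | ha
      · refine ⟨?_, subset_rfl⟩
        rw [List.toFinset_nonempty_iff]
        intro h0; simp [h0] at hl
      · exact ⟨(hm3 a ha).1, (hm3 a ha).2.trans hss.1⟩

theorem SS_map {α R : Type*} [DecidableEq α] [CommRing R] (n : ℕ) (φ : List (Finset α) → R)
    (f : α → α) (l : List α) :
    SS n φ (l.map f) = SS n (fun m => φ (m.map (Finset.image f))) l := by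
  induction n generalizing φ l with
  | zero => simp [SS]
  | succ n ih =>
    simp only [SS]
    rw [dl_map]
    congr 1
    funext l'
    rw [ih]
    have : (l.map f).toFinset = l.toFinset.image f := by ext; simp
    simp [this]

end Cochains
section Tucker

/-- Solve `nm n K = F`. -/
def solveK {p : ℕ} [NeZero p] (n : ℕ) (F : List (ZMod p) → ZMod p) : List (ZMod p) → ZMod p
  | [] => 0
  | a :: l => if Even n then ∑ i ∈ Finset.range a.val, F (TZ ((i : ZMod p) - a) (a :: l))
      else if a = 0 then F (a :: l) else 0

theorem sum_range_zmod {p : ℕ} [NeZero p] (f : ZMod p → ZMod p) :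
    ∑ i ∈ Finset.range p, f (i : ZMod p) = ∑ t, f t := by
  refine Finset.sum_bij (fun i _ => (i : ZMod p)) ?_ ?_ ?_ ?_
  · simp
  · intro i hi j hj h
    simp only [Finset.mem_range] at hi hj
    have := congrArg ZMod.val h
    rwa [ZMod.val_cast_of_lt hi, ZMod.val_cast_of_lt hj] at this
  · intro b _
    exact ⟨b.val, by simpa using ZMod.val_lt b, by simp⟩
  · simp

theorem solveK_spec {p : ℕ} [NeZero p] (hp : 2 ≤ p) (n : ℕ) (F : List (ZMod p) → ZMod p)
    (h0 : F [] = 0) (hF : ∀ l, nm TZ (n + 1) F l = 0) (l : List (ZMod p)) :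
    nm TZ n (solveK n F) l = F l := by
  cases l with
  | nil => simp [nm, solveK, TZ, h0]
  | cons a l =>
    by_cases hn : Even n
    · have hn1 : ¬ Even (n + 1) := by simpa [Nat.even_add_one] using hn
      unfold nm at hF ⊢
      simp only [hn, hn1, if_true, if_false] at hF ⊢
      set y := TZ (-a) (a :: l) with hy
      have e1 : solveK n F (a :: l) = ∑ i ∈ Finset.range a.val, F (TZ (i : ZMod p) y) := by
        simp only [solveK, hn, if_true, hy]
        refine Finset.sum_congr rfl fun i _ => ?_
        rw [TZ_TZ, sub_eq_add_neg]
      have e2 : solveK n F (TZ 1 (a :: l)) =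
          ∑ i ∈ Finset.range (a + 1).val, F (TZ (i : ZMod p) y) := by
        have : TZ 1 (a :: l) = (a + 1) :: TZ 1 l := rfl
        rw [this]
        simp only [solveK, hn, if_true]
        refine Finset.sum_congr rfl fun i _ => ?_
        rw [← this, TZ_TZ, hy, TZ_TZ]
        congr 2; ring
      have e3 : F (TZ (a.val : ZMod p) y) = F (a :: l) := by
        rw [hy, TZ_TZ]; simp [TZ]
      have hlt := ZMod.val_lt a
      have hv1 : (1 : ZMod p).val = 1 := ZMod.val_one'' (by omega)
      rw [e1, e2]
      by_cases ha : a.val + 1 < p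
      · have : (a + 1).val = a.val + 1 := by
          rw [ZMod.val_add_of_lt] <;> rw [hv1]; exact ha
        rw [this, Finset.sum_range_succ, e3]; ring
      · have hap : a.val + 1 = p := by omega
        have : a + 1 = 0 := by
          have := congrArg (Nat.cast : ℕ → ZMod p) hap
          simpa using this
        rw [this]
        have hs := hF y
        have hr : Finset.range p = Finset.range (a.val + 1) := by rw [hap]
        rw [← sum_range_zmod (fun t => F (TZ t y)), hr, Finset.sum_range_succ, e3] at hs
        simp only [ZMod.val_zero, Finset.range_zero, Finset.sum_empty]
        linear_combination -hs
    · have hn1 : Even (n + 1) := by simpa [Nat.even_add_one] using hn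
      unfold nm at hF ⊢
      simp only [hn, hn1, if_true, if_false] at hF ⊢
      have inv : ∀ (i : ℕ) x, F (TZ (i : ZMod p) x) = F x := by
        intro i
        induction i with
        | zero => intro x; simp [TZ]
        | succ i ih =>
          intro x
          have := hF (TZ (i : ZMod p) x)
          rw [TZ_TZ, sub_eq_zero] at this
          push_cast
          rw [add_comm, this, ih]
      rw [Finset.sum_eq_single (-a)]
      · have : TZ (-a) (a :: l) = (a + -a) :: TZ (-a) l := rfl
        rw [this]
        simp only [solveK, hn, if_false]
        rw [if_pos (by ring), ← this]
        have := inv (-a).val (a :: l)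
        simpa using this
      · intro t _ ht
        have : TZ t (a :: l) = (a + t) :: TZ t l := rfl
        rw [this]
        simp only [solveK, hn, if_false]
        rw [if_neg]
        intro h
        exact ht (by linear_combination h)
      · simp

/-- The universal cochains. -/
def KK {p : ℕ} [NeZero p] : ℕ → List (ZMod p) → ZMod p
  | 0 => fun l => if l = [] then 1 else 0
  | n + 1 => solveK n (dl (KK n))

theorem KK_cocycle {p : ℕ} [NeZero p] (hp : 2 ≤ p) (n : ℕ) (l : List (ZMod p)) :
    nm TZ (n + 1) (dl (KK n)) l = 0 := by
  induction n generalizing l with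
  | zero =>
    have : ∀ l : List (ZMod p), dl (KK 0) l = if l.length = 1 then 1 else 0 := by
      intro l
      match l with
      | [] => simp [dl]
      | [a] => simp [dl, KK]
      | a :: b :: l =>
        have : (fun l' : List (ZMod p) => (KK 0 : List (ZMod p) → ZMod p) (a :: l')) = fun _ => 0 := by
          funext l'; simp [KK]
        simp only [dl]
        have h2 : (fun l' : List (ZMod p) => (KK 0 : List (ZMod p) → ZMod p) (a :: b :: l'))
          = fun _ => 0 := by
          funext l'; simp [KK]
        rw [h2, dl_zero]
        simp [KK]
    simp [nm, this, TZ]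
  | succ n ih =>
    have rel : nm TZ n (KK (n + 1) : List (ZMod p) → ZMod p) = dl (KK n) := by
      funext l
      exact solveK_spec hp n _ (by simp [dl]) ih l
    have h := nm_dl (p := p) (fun t v => v + t) (n + 2) (KK (n + 1)) l
    have h2 := nm_add_two (p := p) TZ n (KK (n + 1))
    rw [rel] at h2
    have h3 : nm TZ (n + 2) (dl (KK (n + 1))) l =
        dl (nm (p := p) TZ (n + 2) (KK (n + 1))) l := h
    rw [h2, dl_dl] at h3
    exact h3

theorem KK_rel {p : ℕ} [NeZero p] (hp : 2 ≤ p) (n : ℕ) :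
    nm TZ n (KK (n + 1) : List (ZMod p) → ZMod p) = dl (KK n) := by
  funext l
  exact solveK_spec hp n _ (by simp [dl]) (KK_cocycle hp n) l

theorem Deg_TZ {p : ℕ} (t : ZMod p) (l : List (ZMod p)) (h : Deg l) : Deg (TZ t l) := by
  obtain ⟨l1, a, l2, rfl⟩ := h
  exact ⟨TZ t l1, a + t, TZ t l2, by simp [TZ]⟩

theorem KK_deg {p : ℕ} [NeZero p] (n : ℕ) (l : List (ZMod p)) (h : Deg l) : KK n l = 0 := by
  induction n generalizing l with
  | zero =>
    obtain ⟨l1, a, l2, rfl⟩ := h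
    simp [KK]
  | succ n ih =>
    have hd := dl_deg (KK n : List (ZMod p) → ZMod p) ih
    show solveK n (dl (KK n)) l = 0
    cases l with
    | nil => rfl
    | cons a l =>
      simp only [solveK]
      split_ifs
      · exact Finset.sum_eq_zero fun i _ => hd _ (Deg_TZ _ _ h)
      · exact hd _ h
      · rfl

/-- valid sign vectors -/
def Val {p : ℕ} (N : ℕ) (x : Finset (ZMod p × ℕ)) : Prop :=
  x.Nonempty ∧ (∀ v ∈ x, v.2 < N) ∧ ∀ v ∈ x, ∀ w ∈ x, v.2 = w.2 → v = w

theorem deg_of_levels {β : Type*} {γ : Type*} (M : ℕ) (f : β → γ) (lev : β → ℕ) (R : β → β → Prop)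
    (P : β → Prop)
    (hM : ∀ a, P a → lev a < M)
    (hmono : ∀ a b, P a → P b → R a b → lev b ≤ lev a)
    (hsame : ∀ a b, P a → P b → R a b → lev b = lev a → f b = f a)
    (m : List β) (hm : m.Pairwise R) (hP : ∀ a ∈ m, P a) (hlen : M < m.length) : Deg (m.map f) := by
  by_contra hcon
  have key : ∀ m : List β, m.Pairwise R → (∀ a ∈ m, P a) → ¬ Deg (m.map f) →
      (m.map lev).Pairwise (fun a b => b < a) := by
    intro m
    induction m with
    | nil => simp
    | cons a m ih =>
      intro h1 h2 h3
      have h4 := ih h1.of_cons (fun b hb => h2 b (List.mem_cons_of_mem _ hb)) (by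
        rintro ⟨l1, c, l2, h⟩
        exact h3 ⟨f a :: l1, c, l2, by simp [h]⟩)
      cases m with
      | nil => simp
      | cons b m =>
        have hab : R a b := (List.pairwise_cons.1 h1).1 b (by simp)
        have Pa := h2 a (by simp)
        have Pb := h2 b (by simp)
        have hlt : lev b < lev a := by
          refine lt_of_le_of_ne (hmono a b Pa Pb hab) fun h => ?_
          have := hsame a b Pa Pb hab h
          exact h3 ⟨[], f a, m.map f, by simp [this]⟩
        simp only [List.map_cons] at h4 ⊢
        refine List.Pairwise.cons ?_ h4
        intro c hc
        rcases List.mem_cons.1 hc with rfl | hc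
        · exact hlt
        · exact ((List.pairwise_cons.1 h4).1 c hc).trans hlt
  have h := key m hm hP hcon
  have hnd : (m.map lev).Nodup := h.imp (fun h => ne_of_gt h)
  have hc := List.toFinset_card_of_nodup hnd
  have hsub : (m.map lev).toFinset ⊆ Finset.range M := by
    intro x hx
    simp only [List.mem_toFinset, List.mem_map] at hx
    obtain ⟨a, ha, rfl⟩ := hx
    simpa using hM a (hP a ha)
  have := Finset.card_le_card hsub
  simp only [Finset.card_range] at this
  rw [hc, List.length_map] at this
  omega

theorem val_of_list {p : ℕ} {N d : ℕ} (hd : d < N) (l : List (ZMod p × ℕ))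
    (hl : l.map Prod.snd = (List.range (d + 1)).reverse) (a : Finset (ZMod p × ℕ))
    (ha : a.Nonempty) (hs : a ⊆ l.toFinset) : Val N a := by
  refine ⟨ha, ?_, ?_⟩
  · intro v hv
    have : v.2 ∈ l.map Prod.snd := List.mem_map_of_mem (by simpa using hs hv)
    rw [hl] at this
    simp at this; omega
  · intro v hv w hw h
    have hnd : (l.map Prod.snd).Nodup := by
      rw [hl]; exact List.nodup_reverse.2 List.nodup_range
    exact List.inj_on_of_nodup_map hnd (by simpa using hs hv) (by simpa using hs hw) h

theorem zp_tucker {p : ℕ} [NeZero p] (hp : 2 ≤ p) (N M : ℕ)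
    (sgn : Finset (ZMod p × ℕ) → ZMod p) (lev : Finset (ZMod p × ℕ) → ℕ)
    (heq : ∀ x t, Val N x → sgn (x.image (fun v => (v.1 + t, v.2))) = sgn x + t)
    (hM : ∀ x, Val N x → lev x < M)
    (hmono : ∀ x y, Val N x → Val N y → y ⊂ x → lev y ≤ lev x)
    (hsame : ∀ x y, Val N x → Val N y → y ⊂ x → lev y = lev x → sgn y = sgn x) : N ≤ M := by
  by_contra hcon
  have one : ∀ d, d < N →
      HH d (SS (d + 1) (fun m => dl (KK d : List (ZMod p) → ZMod p) (m.map sgn))) = 1 := by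
    intro d
    induction d with
    | zero => intro _; simp [HH, SS, dl, KK]
    | succ d ih =>
      intro hd
      rw [← ih (by omega)]
      have e1 : (fun m : List (Finset (ZMod p × ℕ)) =>
          dl (KK (d + 1) : List (ZMod p) → ZMod p) (m.map sgn)) =
          dl (fun m => KK (d + 1) (m.map sgn)) := by
        funext m; exact dl_map _ _ _
      rw [e1]
      rw [HH_congr (d + 1) _ (dl (SS (d + 1) (fun m => KK (d + 1) (m.map sgn))))]
      · rw [HH_dl]
        apply HH_congr
        intro l hl
        have hlen : l.length = d + 1 := by
          have := congrArg List.length hl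
          simpa using this
        have hnd : l.Nodup := by
          have : (l.map Prod.snd).Nodup := by
            rw [hl]; exact List.nodup_reverse.2 List.nodup_range
          exact List.Nodup.of_map _ this
        have key : ∀ t, SS (d + 1) (fun m => KK (d + 1) (m.map sgn)) (TV t l) =
            SS (d + 1) (fun m => KK (d + 1) (TZ t (m.map sgn))) l := by
          intro t
          rw [SS_map]
          apply SS_congr _ _ _ _ hlen hnd
          intro m _ _ hm
          congr 1
          simp only [List.map_map, TZ]
          apply List.map_congr_left
          intro a ha
          simp only [Function.comp]
          exact heq a t (val_of_list (by omega) l hl a (hm a ha).1 (hm a ha).2)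
        have key0 : SS (d + 1) (fun m => KK (d + 1) (m.map sgn)) l =
            SS (d + 1) (fun m => KK (d + 1) (m.map sgn)) l := rfl
        rw [← KK_rel hp d]
        unfold nm
        split_ifs with he
        · rw [key, SS_sub]
        · rw [SS_sum]
          exact Finset.sum_congr rfl fun t _ => key t
      · intro l hl
        apply SS_dl
        have := congrArg List.length hl
        simpa using this
  have h1 := one (N - 1) (by omega)
  rw [HH_congr (N - 1) _ (fun _ => 0), HH_zero] at h1
  · have : Fact (1 < p) := ⟨by omega⟩
    exact zero_ne_one h1
  · intro l hl
    have hlen : l.length = N - 1 + 1 := by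
      have := congrArg List.length hl
      simpa using this
    have hnd : l.Nodup := by
      have : (l.map Prod.snd).Nodup := by
        rw [hl]; exact List.nodup_reverse.2 List.nodup_range
      exact List.Nodup.of_map _ this
    rw [SS_congr (N - 1 + 1) _ (fun _ => 0) l hlen hnd]
    · have := SS_sub (N - 1 + 1) (fun _ => (0 : ZMod p)) (fun _ => 0) l
      simpa using this
    · intro m hm1 hm2 hm3
      apply dl_deg _ (KK_deg (N - 1))
      refine deg_of_levels M sgn lev (fun a b => b ⊂ a) (Val N) hM hmono hsame m hm2 ?_ (by omega)
      intro a ha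
      exact val_of_list (by omega) l hl a (hm3 a ha).1 (hm3 a ha).2

end Tucker
section PrimeCase

set_option linter.unusedSectionVars false

/-- average of a subset of `ZMod p` -/
def avg {p : ℕ} (S : Finset (ZMod p)) : ZMod p := (∑ j ∈ S, j) * (S.card : ZMod p)⁻¹

theorem avg_shift {p : ℕ} [Fact p.Prime] (S : Finset (ZMod p)) (t : ZMod p) (h0 : 0 < S.card)
    (h1 : S.card < p) : avg (S.image (fun j => j + t)) = avg S + t := by
  have hinj : Function.Injective (fun j : ZMod p => j + t) := add_left_injective t
  have hne : (S.card : ZMod p) ≠ 0 := by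
    intro h
    rw [ZMod.natCast_eq_zero_iff] at h
    exact absurd (Nat.le_of_dvd h0 h) (by omega)
  unfold avg
  rw [Finset.card_image_of_injective _ hinj, Finset.sum_image (fun a _ b _ h => hinj h),
    Finset.sum_add_distrib, Finset.sum_const, nsmul_eq_mul]
  field_simp

variable {ι : Type} [Fintype ι] [DecidableEq ι] {p : ℕ} [Fact p.Prime]

open Classical in
/-- indices whose set contains a `k`-set of color `col` -/
noncomputable def hiS (k : ℕ) (c : Finset ι → ℕ) (B : ZMod p → Finset ι) (col : ℕ) :
    Finset (ZMod p) :=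
  univ.filter fun j => ∃ A ⊆ B j, A.card = k ∧ c A = col

open Classical in
noncomputable def colsS (m k : ℕ) (c : Finset ι → ℕ) (B : ZMod p → Finset ι) : Finset ℕ :=
  (range m).filter fun col => (hiS k c B col).Nonempty

noncomputable def topS (m k : ℕ) (c : Finset ι → ℕ) (B : ZMod p → Finset ι) : ℕ :=
  (colsS m k c B).sup id

open Classical in
noncomputable def levB (m k : ℕ) (c : Finset ι → ℕ) (B : ZMod p → Finset ι) : ℕ :=
  if (colsS m k c B).Nonempty then
    p * (k - 1) + topS m k c B * (p - 1) + (hiS k c B (topS m k c B)).card - 1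
  else (∑ j, (B j).card) - 1

/-- index set of `i` -/
def suppB (B : ZMod p → Finset ι) (i : ι) : Finset (ZMod p) := univ.filter fun j => i ∈ B j

open Classical in
noncomputable def sgnB (m k : ℕ) (c : Finset ι → ℕ) (pick : Finset ι → ι)
    (B : ZMod p → Finset ι) : ZMod p :=
  if (colsS m k c B).Nonempty then avg (hiS k c B (topS m k c B))
  else avg (suppB B (pick (univ.biUnion B)))

theorem hiS_shift (k : ℕ) (c : Finset ι → ℕ) (B : ZMod p → Finset ι) (col : ℕ) (t : ZMod p) :
    hiS k c (fun j => B (j - t)) col = (hiS k c B col).image (fun j => j + t) := by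
  ext j
  simp only [hiS, mem_filter, mem_univ, true_and, mem_image]
  constructor
  · intro h; exact ⟨j - t, h, by ring⟩
  · rintro ⟨j', h, rfl⟩; simpa using h

theorem colsS_shift (m k : ℕ) (c : Finset ι → ℕ) (B : ZMod p → Finset ι) (t : ZMod p) :
    colsS m k c (fun j => B (j - t)) = colsS m k c B := by
  unfold colsS
  simp only [hiS_shift, image_nonempty]

theorem topS_shift (m k : ℕ) (c : Finset ι → ℕ) (B : ZMod p → Finset ι) (t : ZMod p) :
    topS m k c (fun j => B (j - t)) = topS m k c B := by
  unfold topS; rw [colsS_shift]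

theorem topS_mem {m k : ℕ} {c : Finset ι → ℕ} {B : ZMod p → Finset ι}
    (h : (colsS m k c B).Nonempty) : topS m k c B < m ∧ (hiS k c B (topS m k c B)).Nonempty := by
  obtain ⟨x, hx, he⟩ := Finset.exists_mem_eq_sup _ h id
  have : topS m k c B = x := he
  rw [this]
  simpa [colsS] using hx

theorem hiS_mono {k : ℕ} {c : Finset ι → ℕ} {B B' : ZMod p → Finset ι} (h : ∀ j, B j ⊆ B' j)
    (col : ℕ) : hiS k c B col ⊆ hiS k c B' col := by
  intro j
  simp only [hiS, mem_filter, mem_univ, true_and]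
  rintro ⟨A, h1, h2⟩
  exact ⟨A, h1.trans (h j), h2⟩

theorem colsS_mono {m k : ℕ} {c : Finset ι → ℕ} {B B' : ZMod p → Finset ι} (h : ∀ j, B j ⊆ B' j) :
    colsS m k c B ⊆ colsS m k c B' := by
  intro x
  simp only [colsS, mem_filter]
  rintro ⟨h1, h2⟩
  exact ⟨h1, h2.mono (hiS_mono h x)⟩

/-- admissible families -/
def Adm (s : ι → ℕ) (B : ZMod p → Finset ι) : Prop :=
  (∀ i, (suppB B i).card ≤ s i) ∧ ∃ j, (B j).Nonempty

/-- no monochromatic hyperedge -/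
def NoMono (p : ℕ) (k : ℕ) (s : ι → ℕ) (c : Finset ι → ℕ) : Prop :=
  ∀ A : ZMod p → Finset ι, (∀ j, (A j).card = k) →
    (∀ i (S : Finset (ZMod p)), (∀ j ∈ S, i ∈ A j) → S.card ≤ s i) →
    ¬ ∃ col, ∀ j, c (A j) = col

theorem hiS_card_lt {k : ℕ} {s : ι → ℕ} {c : Finset ι → ℕ} (hno : NoMono p k s c)
    {B : ZMod p → Finset ι} (hB : Adm s B) (col : ℕ) : (hiS k c B col).card < p := by
  have hle : (hiS k c B col).card ≤ p := by
    simpa [ZMod.card] using Finset.card_le_univ (hiS k c B col)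
  refine lt_of_le_of_ne hle fun he => ?_
  have huniv : hiS k c B col = univ := by
    apply Finset.eq_univ_of_card
    rw [he, ZMod.card]
  have : ∀ j : ZMod p, ∃ A ⊆ B j, A.card = k ∧ c A = col := by
    intro j
    have : j ∈ hiS k c B col := by rw [huniv]; simp
    simpa [hiS] using this
  choose A h1 h2 h3 using this
  refine hno A h2 ?_ ⟨col, h3⟩
  intro i S hS
  refine le_trans (Finset.card_le_card ?_) (hB.1 i)
  intro j hj
  simp only [suppB, mem_filter, mem_univ, true_and]
  exact h1 j (hS j hj)

theorem low_sum {m k : ℕ} {c : Finset ι → ℕ} (hc : ∀ A, c A < m) (hk : 1 ≤ k)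
    {B : ZMod p → Finset ι} (h : ¬ (colsS m k c B).Nonempty) : ∑ j, (B j).card ≤ p * (k - 1) := by
  have : ∀ j, (B j).card ≤ k - 1 := by
    intro j
    by_contra hlt
    obtain ⟨A, hA1, hA2⟩ := Finset.exists_subset_card_eq (s := B j) (n := k) (by omega)
    apply h
    refine ⟨c A, ?_⟩
    simp only [colsS, mem_filter, mem_range]
    refine ⟨hc A, j, ?_⟩
    simp only [hiS, mem_filter, mem_univ, true_and]
    exact ⟨A, hA1, hA2, rfl⟩
  calc ∑ j, (B j).card ≤ ∑ j : ZMod p, (k - 1) := Finset.sum_le_sum fun j _ => this j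
    _ = p * (k - 1) := by simp [ZMod.card]

theorem adm_sum_pos {s : ι → ℕ} {B : ZMod p → Finset ι} (hB : Adm s B) : 1 ≤ ∑ j, (B j).card := by
  obtain ⟨j, hj⟩ := hB.2
  exact le_trans hj.card_pos (Finset.single_le_sum (f := fun j => (B j).card)
    (fun _ _ => Nat.zero_le _) (mem_univ j))

theorem levB_lt {m k : ℕ} {s : ι → ℕ} {c : Finset ι → ℕ} (hc : ∀ A, c A < m) (hk : 1 ≤ k)
    (hno : NoMono p k s c) {B : ZMod p → Finset ι} (hB : Adm s B) :
    levB m k c B < p * (k - 1) + (p - 1) * m := by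
  have hp := (Fact.out : p.Prime).two_le
  unfold levB
  split_ifs with h
  · obtain ⟨h1, h2⟩ := topS_mem h
    have h3 := hiS_card_lt hno hB (topS m k c B)
    have h4 := h2.card_pos
    have h5 : (topS m k c B + 1) * (p - 1) ≤ m * (p - 1) := Nat.mul_le_mul_right _ h1
    rw [add_mul, one_mul] at h5
    rw [mul_comm (p - 1) m]
    omega
  · have := low_sum hc hk h
    have := adm_sum_pos hB
    omega

theorem levB_mono {m k : ℕ} {s : ι → ℕ} {c : Finset ι → ℕ} (hc : ∀ A, c A < m) (hk : 1 ≤ k)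
    (hno : NoMono p k s c) (pick : Finset ι → ι) {B B' : ZMod p → Finset ι}
    (hB : Adm s B) (hB' : Adm s B')
    (hsub : ∀ j, B j ⊆ B' j) : levB m k c B ≤ levB m k c B' ∧
      (levB m k c B = levB m k c B' → sgnB m k c pick B = sgnB m k c pick B') := by
  have hp := (Fact.out : p.Prime).two_le
  by_cases h : (colsS m k c B).Nonempty
  · have h' : (colsS m k c B').Nonempty := h.mono (colsS_mono hsub)
    obtain ⟨h1, h2⟩ := topS_mem h
    obtain ⟨h1', h2'⟩ := topS_mem h'
    have h3 := hiS_card_lt hno hB (topS m k c B)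
    have h4 := h2.card_pos
    have h3' := hiS_card_lt hno hB' (topS m k c B')
    have h4' := h2'.card_pos
    have htop : topS m k c B ≤ topS m k c B' := Finset.sup_mono (colsS_mono hsub)
    unfold levB sgnB
    simp only [h, h', if_true]
    rcases htop.lt_or_eq with hlt | heq
    · have h5 : (topS m k c B + 1) * (p - 1) ≤ topS m k c B' * (p - 1) :=
        Nat.mul_le_mul_right _ hlt
      rw [add_mul, one_mul] at h5
      constructor
      · omega
      · intro; omega
    · rw [← heq] at h3' h4' ⊢
      have hs := hiS_mono (k := k) (c := c) hsub (topS m k c B)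
      have := Finset.card_le_card hs
      refine ⟨by omega, fun he => ?_⟩
      rw [Finset.eq_of_subset_of_card_le hs (by omega)]
  · have hlow := low_sum hc hk h
    have hpos := adm_sum_pos hB
    by_cases h' : (colsS m k c B').Nonempty
    · obtain ⟨h1', h2'⟩ := topS_mem h'
      have h4' := h2'.card_pos
      unfold levB sgnB
      simp only [h, h', if_true, if_false]
      constructor
      · omega
      · intro; omega
    · have hle : ∀ j, (B j).card ≤ (B' j).card := fun j => Finset.card_le_card (hsub j)
      have hle2 := Finset.sum_le_sum (s := univ) fun j _ => hle j
      have hpos' := adm_sum_pos hB'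
      unfold levB sgnB
      simp only [h, h', if_false]
      refine ⟨by omega, fun he => ?_⟩
      have : B = B' := by
        have h5 : ∑ j, (B j).card = ∑ j, (B' j).card := by omega
        rw [Finset.sum_eq_sum_iff_of_le fun j _ => hle j] at h5
        funext j
        exact Finset.eq_of_subset_of_card_le (hsub j) (h5 j (mem_univ j)).ge
      rw [this]

theorem sgnB_shift {m k : ℕ} {s : ι → ℕ} {c : Finset ι → ℕ} (hs : ∀ i, s i ≤ p - 1)
    (hno : NoMono p k s c) (pick : Finset ι → ι) (hpick : ∀ U : Finset ι, U.Nonempty → pick U ∈ U)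
    {B : ZMod p → Finset ι} (hB : Adm s B) (t : ZMod p) :
    sgnB m k c pick (fun j => B (j - t)) = sgnB m k c pick B + t := by
  have hp := (Fact.out : p.Prime).two_le
  unfold sgnB
  rw [colsS_shift, topS_shift, hiS_shift]
  split_ifs with h
  · exact avg_shift _ _ (topS_mem h).2.card_pos (hiS_card_lt hno hB _)
  · have e1 : (univ.biUnion fun j => B (j - t)) = univ.biUnion B := by
      ext i
      simp only [mem_biUnion, mem_univ, true_and]
      constructor
      · rintro ⟨j, hj⟩; exact ⟨_, hj⟩
      · rintro ⟨j, hj⟩; exact ⟨j + t, by simpa using hj⟩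
    rw [e1]
    have e2 : ∀ i, suppB (fun j => B (j - t)) i = (suppB B i).image (fun j => j + t) := by
      intro i
      ext j
      simp only [suppB, mem_filter, mem_univ, true_and, mem_image]
      constructor
      · intro h; exact ⟨j - t, h, by ring⟩
      · rintro ⟨j', h, rfl⟩; simpa using h
    rw [e2]
    apply avg_shift
    · obtain ⟨j, i, hi⟩ := hB.2
      have : pick (univ.biUnion B) ∈ univ.biUnion B :=
        hpick _ ⟨i, by simp only [mem_biUnion, mem_univ, true_and]; exact ⟨j, hi⟩⟩
      simp only [mem_biUnion, mem_univ, true_and] at this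
      obtain ⟨j, hj⟩ := this
      exact Finset.card_pos.2 ⟨j, by simpa [suppB] using hj⟩
    · have := hB.1 (pick (univ.biUnion B))
      have := hs (pick (univ.biUnion B))
      omega

theorem prime_lt (m k : ℕ) (s : ι → ℕ) (c : Finset ι → ℕ) (hc : ∀ A, c A < m) (hk : 1 ≤ k)
    (hs : ∀ i, s i ≤ p - 1) (hno : NoMono p k s c) :
    ∑ i, s i ≤ p * (k - 1) + (p - 1) * m := by
  have hp := (Fact.out : p.Prime).two_le
  set N := ∑ i, s i with hN
  rcases Nat.eq_zero_or_pos N with h0 | hpos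
  · omega
  have hne : Nonempty ι := by
    by_contra h
    rw [not_nonempty_iff] at h
    simp at hN
    omega
  -- the projection from copies
  have hcard : Fintype.card (Σ i, Fin (s i)) = N := by simp [hN]
  let e : (Σ i, Fin (s i)) ≃ Fin N := Fintype.equivFinOfCardEq hcard
  let π : ℕ → ι := fun t => if h : t < N then (e.symm ⟨t, h⟩).1 else Classical.arbitrary ι
  have hfib : ∀ i, ((range N).filter fun t => π t = i).card ≤ s i := by
    intro i
    have : ((range N).filter fun t => π t = i) ⊆
        (univ : Finset (Fin (s i))).image (fun a => (e ⟨i, a⟩ : ℕ)) := by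
      intro t ht
      simp only [mem_filter, mem_range] at ht
      obtain ⟨h1, h2⟩ := ht
      simp only [π, h1, dif_pos] at h2
      simp only [mem_image, mem_univ, true_and]
      subst h2
      exact ⟨(e.symm ⟨t, h1⟩).2, by simp⟩
    refine (Finset.card_le_card this).trans (Finset.card_image_le.trans ?_)
    simp
  let pick : Finset ι → ι := fun U => if h : U.Nonempty then h.choose else Classical.arbitrary ι
  have hpick : ∀ U : Finset ι, U.Nonempty → pick U ∈ U := by
    intro U hU
    simp only [pick, hU, dif_pos]
    exact hU.choose_spec
  let BB : Finset (ZMod p × ℕ) → ZMod p → Finset ι := fun x j =>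
    (x.filter fun v => v.1 = j).image fun v => π v.2
  have memBB : ∀ x j i, i ∈ BB x j ↔ ∃ t, (j, t) ∈ x ∧ π t = i := by
    intro x j i
    simp only [BB, mem_image, mem_filter]
    constructor
    · rintro ⟨⟨a, b⟩, ⟨h1, rfl⟩, h2⟩; exact ⟨b, h1, h2⟩
    · rintro ⟨t, h1, h2⟩; exact ⟨(j, t), ⟨h1, rfl⟩, h2⟩
  have hadm : ∀ x, Val N x → Adm s (BB x) := by
    rintro x ⟨⟨⟨a, b⟩, hv⟩, h1, h2⟩
    refine ⟨fun i => ?_, a, π b, (memBB _ _ _).2 ⟨b, hv, rfl⟩⟩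
    refine le_trans ?_ (hfib i)
    have : ∀ j : ZMod p, ∃ t, j ∈ suppB (BB x) i → (j, t) ∈ x ∧ π t = i := by
      intro j
      by_cases hj : j ∈ suppB (BB x) i
      · obtain ⟨t, ht⟩ := (memBB x j i).1 (by simpa [suppB] using hj)
        exact ⟨t, fun _ => ht⟩
      · exact ⟨0, fun h => absurd h hj⟩
    choose f hf using this
    refine Finset.card_le_card_of_injOn f ?_ ?_
    · intro j hj
      have := hf j hj
      simp only [coe_filter, Set.mem_ofPred_eq, mem_range]
      exact ⟨h1 _ this.1, this.2⟩
    · intro j hj j' hj' h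
      have := h2 _ (hf j hj).1 _ (hf j' hj').1 h
      exact congrArg Prod.fst this
  have hsub : ∀ x y : Finset (ZMod p × ℕ), y ⊂ x → ∀ j, BB y j ⊆ BB x j := by
    intro x y h j i
    rw [memBB, memBB]
    rintro ⟨t, h1, h2⟩
    exact ⟨t, h.1 h1, h2⟩
  refine zp_tucker hp N _ (fun x => sgnB m k c pick (BB x)) (fun x => levB m k c (BB x))
    ?_ ?_ ?_ ?_
  · intro x t hx
    rw [← sgnB_shift hs hno pick hpick (hadm x hx) t]
    congr 1
    funext j
    ext i
    rw [memBB, memBB]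
    constructor
    · rintro ⟨u, h1, h2⟩
      simp only [mem_image] at h1
      obtain ⟨⟨a, b⟩, h3, h4⟩ := h1
      simp only [Prod.mk.injEq] at h4
      obtain ⟨rfl, rfl⟩ := h4
      exact ⟨b, by simpa using h3, h2⟩
    · rintro ⟨u, h1, h2⟩
      exact ⟨u, by simp only [mem_image]; exact ⟨_, h1, by simp⟩, h2⟩
  · intro x hx
    exact levB_lt hc hk hno (hadm x hx)
  · intro x y hx hy h
    exact (levB_mono hc hk hno pick (hadm y hy) (hadm x hx) (hsub x y h)).1
  · intro x y hx hy h
    exact (levB_mono hc hk hno pick (hadm y hy) (hadm x hx) (hsub x y h)).2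

end PrimeCase
section Composite

/-- The multiplicity statement for `r`. -/
def MM (r : ℕ) : Prop :=
  ∀ (ι : Type) [Fintype ι] [DecidableEq ι] (s : ι → ℕ) (m k : ℕ) (c : Finset ι → ℕ),
    (∀ A, c A < m) → 1 ≤ k → (∀ i, s i ≤ r) → r * (k - 1) + (r - 1) * m + 1 ≤ ∑ i, s i →
    ∃ A : Fin r → Finset ι, (∀ j, (A j).card = k) ∧
      (∀ i, ((univ : Finset (Fin r)).filter fun j => i ∈ A j).card ≤ s i) ∧
      ∀ j j', c (A j) = c (A j')

theorem MM_one : MM 1 := by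
  intro ι _ _ s m k c hc hk hs hsum
  have h1 : ∑ i, s i = (univ.filter fun i => s i = 1).card := by
    rw [Finset.card_filter]
    refine Finset.sum_congr rfl fun i _ => ?_
    have := hs i
    split_ifs <;> omega
  obtain ⟨A, hA1, hA2⟩ := Finset.exists_subset_card_eq
    (s := univ.filter fun i => s i = 1) (n := k) (by rw [← h1]; omega)
  refine ⟨fun _ => A, fun _ => hA2, ?_, fun _ _ => rfl⟩
  intro i
  by_cases hi : i ∈ A
  · have := hA1 hi
    simp only [mem_filter, mem_univ, true_and] at this
    rw [this]
    exact (Finset.card_le_univ _).trans (by simp)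
  · simp [hi]

theorem MM_prime {p : ℕ} (hp : p.Prime) : MM p := by
  intro ι _ _ s m k c hc hk hs hsum
  have : Fact p.Prime := ⟨hp⟩
  have hp2 := hp.two_le
  set D := univ.filter fun i => s i = p with hD
  have memD : ∀ i, i ∈ D ↔ s i = p := by intro i; simp [hD]
  by_cases hkD : k ≤ D.card
  · obtain ⟨A, hA1, hA2⟩ := Finset.exists_subset_card_eq hkD
    refine ⟨fun _ => A, fun _ => hA2, ?_, fun _ _ => rfl⟩
    intro i
    by_cases hi : i ∈ A
    · rw [(memD i).1 (hA1 hi)]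
      exact (Finset.card_le_univ _).trans (by simp)
    · simp [hi]
  · have hsum' : ∑ i, s i = ∑ i, (if s i = p then 0 else s i) + p * D.card := by
      rw [hD, Finset.card_filter, Finset.mul_sum, ← Finset.sum_add_distrib]
      refine Finset.sum_congr rfl fun i _ => ?_
      split_ifs with h <;> simp [h]
    have hnot : ¬ NoMono p (k - D.card) (fun i => if s i = p then 0 else s i)
        (fun A => c (A ∪ D)) := by
      intro hno
      have := prime_lt m (k - D.card) (fun i => if s i = p then 0 else s i)
        (fun A => c (A ∪ D)) (fun A => hc _) (by omega) (by
          intro i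
          have := hs i
          split_ifs <;> omega) hno
      have e : p * (k - 1) = p * (k - D.card - 1) + p * D.card := by
        rw [← mul_add]; congr 1; omega
      omega
    unfold NoMono at hnot
    push Not at hnot
    obtain ⟨A, h1, h2, col, h3⟩ := hnot
    have hdisj : ∀ j, Disjoint (A j) D := by
      intro j
      rw [Finset.disjoint_left]
      intro i hi hiD
      have := h2 i {j} (by simpa using hi)
      rw [if_pos ((memD i).1 hiD)] at this
      simp at this
    let e : Fin p ≃ ZMod p := Fintype.equivOfCardEq (by simp [ZMod.card])
    refine ⟨fun j => A (e j) ∪ D, ?_, ?_, ?_⟩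
    · intro j
      rw [Finset.card_union_of_disjoint (hdisj _), h1]; omega
    · intro i
      by_cases hi : i ∈ D
      · rw [(memD i).1 hi]
        exact (Finset.card_le_univ _).trans (by simp)
      · have h4 := h2 i ((univ.filter fun j => i ∈ A (e j)).map e.toEmbedding) (by
          intro j hj
          simp only [mem_map, mem_filter, mem_univ, true_and] at hj
          obtain ⟨j', h, rfl⟩ := hj
          exact h)
        rw [if_neg (fun h => hi ((memD i).2 h)), Finset.card_map] at h4
        simpa [hi] using h4
    · intro j j'
      rw [h3 (e j), h3 (e j')]

theorem sum_min (p a s : ℕ) : ∑ b ∈ range a, min p (s - p * b) = min s (p * a) := by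
  induction a with
  | zero => simp
  | succ a ih =>
    rw [Finset.sum_range_succ, ih, Nat.mul_succ]
    omega

theorem MM_mul {p a : ℕ} (hp1 : 1 ≤ p) (ha1 : 1 ≤ a) (hp : MM p) (ha : MM a) : MM (p * a) := by
  intro ι _ _ s m k c hc hk hs hsum
  set k' := a * (k - 1) + (a - 1) * m + 1 with hk'
  let tv : Finset (ι × Fin a) → ι → ℕ := fun T i => (univ.filter fun b => (i, b) ∈ T).card
  have htv_sum : ∀ T, ∑ i, tv T i = T.card := by
    intro T
    simp only [tv, Finset.card_filter]
    rw [← Fintype.sum_prod_type' (f := fun i b => if (i, b) ∈ T then 1 else 0)]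
    simp
  have inner : ∀ T : Finset (ι × Fin a), ∃ A : Fin a → Finset ι, T.card = k' →
      (∀ j, (A j).card = k) ∧
      (∀ i, ((univ : Finset (Fin a)).filter fun j => i ∈ A j).card ≤ tv T i) ∧
      ∀ j j', c (A j) = c (A j') := by
    intro T
    by_cases hT : T.card = k'
    · obtain ⟨A, hA⟩ := ha ι (tv T) m k c hc hk
        (fun i => (Finset.card_le_univ _).trans (by simp)) (by rw [htv_sum, hT])
      exact ⟨A, fun _ => hA⟩
    · exact ⟨fun _ => ∅, fun h => absurd h hT⟩
  choose F hF using inner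
  let z : Fin a := ⟨0, by omega⟩
  let s' : ι × Fin a → ℕ := fun x => min p (s x.1 - p * x.2.val)
  have hs' : ∀ i, ∑ b, s' (i, b) = s i := by
    intro i
    have h1 := sum_min p a (s i)
    rw [Finset.sum_range] at h1
    simp only [s']
    rw [h1]
    exact min_eq_left (hs i)
  obtain ⟨T, hT1, hT2, hT3⟩ := hp (ι × Fin a) s' m k' (fun T => c (F T z)) (fun T => hc _)
    (by omega) (fun x => min_le_left _ _) (by
      rw [Fintype.sum_prod_type]
      simp only [hs']
      refine le_trans (le_of_eq ?_) hsum
      have : k' - 1 = a * (k - 1) + (a - 1) * m := by omega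
      rw [this]
      obtain ⟨a', rfl⟩ : ∃ a', a = a' + 1 := ⟨a - 1, by omega⟩
      obtain ⟨p', rfl⟩ : ∃ p', p = p' + 1 := ⟨p - 1, by omega⟩
      have h2 : (p' + 1) * (a' + 1) - 1 = (p' + 1) * a' + p' := by
        rw [Nat.mul_succ]; omega
      rw [h2]
      simp only [Nat.add_sub_cancel]
      ring)
  let e : Fin (p * a) ≃ Fin p × Fin a := finProdFinEquiv.symm
  refine ⟨fun x => F (T (e x).1) (e x).2, ?_, ?_, ?_⟩
  · intro x
    exact (hF _ (hT1 _)).1 _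
  · intro i
    have h1 : ((univ : Finset (Fin (p * a))).filter fun x => i ∈ F (T (e x).1) (e x).2).card =
        ∑ j : Fin p, (univ.filter fun l : Fin a => i ∈ F (T j) l).card := by
      simp only [Finset.card_filter]
      rw [← Fintype.sum_prod_type' (f := fun j l => if i ∈ F (T j) l then 1 else 0)]
      exact Fintype.sum_equiv e _ _ (fun x => rfl)
    rw [h1]
    calc ∑ j : Fin p, (univ.filter fun l : Fin a => i ∈ F (T j) l).card
        ≤ ∑ j : Fin p, tv (T j) i := Finset.sum_le_sum fun j _ => (hF _ (hT1 j)).2.1 i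
      _ = ∑ b : Fin a, (univ.filter fun j => (i, b) ∈ T j).card := by
          simp only [tv, Finset.card_filter]
          exact Finset.sum_comm
      _ ≤ ∑ b : Fin a, s' (i, b) := Finset.sum_le_sum fun b _ => hT2 (i, b)
      _ = s i := hs' i
  · intro x y
    rw [(hF _ (hT1 (e x).1)).2.2 (e x).2 z, (hF _ (hT1 (e y).1)).2.2 (e y).2 z]
    exact hT3 _ _

theorem MM_all (r : ℕ) (hr : 1 ≤ r) : MM r := by
  induction r using Nat.recOnMul with
  | zero => omega
  | one => exact MM_one
  | prime p hp => exact MM_prime hp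
  | mul a b iha ihb =>
    have ha : 1 ≤ a := Nat.pos_of_ne_zero (by rintro rfl; simp at hr)
    have hb : 1 ≤ b := Nat.pos_of_ne_zero (by rintro rfl; simp at hr)
    exact MM_mul ha hb (iha ha) (ihb hb)

theorem bfun_le (r : ℕ) (hr : r ≠ 0) : bfun r ≤ r := by
  conv_rhs => rw [← Nat.prod_factorization_pow_eq_self hr]
  unfold bfun Finsupp.prod
  refine Finset.prod_le_prod' fun q _ => ?_
  apply Nat.pow_le_pow_left
  split_ifs <;> omega

end Composite

/-- `χ(KG^r_s(n,k)) ≥ ⌈((Σᵢ sᵢ) - r(k-1))/(r-1)⌉` for `sᵢ ∈ {1,…,b(r)-1}`. -/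
theorem stmt3 (r n k : ℕ) (hr : 2 ≤ r) (hk : 1 ≤ k) (hn : 1 ≤ n)
    (s : Fin n → ℕ) (hs : ∀ i, 1 ≤ s i ∧ s i ≤ bfun r - 1) :
    cld ((∑ i, s i) - r * (k - 1)) (r - 1) ≤ chiS r n k s := by
  have hb := bfun_le r (by omega)
  have hsr : ∀ i, s i ≤ r - 1 := fun i => (hs i).2.trans (by omega)
  unfold chiS
  apply le_csInf
  · -- the injective coloring is proper
    refine ⟨Fintype.card (Finset (Fin n)), Fintype.equivFin (Finset (Fin n)), ?_⟩
    intro A hA1 hA2 hA3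
    let z : Fin r := ⟨0, by omega⟩
    have hz : ∀ j, A j = A z := fun j => (Fintype.equivFin (Finset (Fin n))).injective (hA3 j z)
    obtain ⟨i, hi⟩ : (A z).Nonempty := Finset.card_pos.1 (by rw [hA1]; omega)
    have h1 := hA2 i
    have h2 : (univ : Finset (Fin r)).filter (fun j => i ∈ A j) = univ := by
      ext j
      simp only [mem_filter, mem_univ, true_and, iff_true]
      rw [hz j]; exact hi
    rw [h2, Finset.card_univ, Fintype.card_fin] at h1
    have := hsr i
    omega
  · rintro m ⟨c, hc⟩
    by_contra hlt
    have hbig : r * (k - 1) + (r - 1) * m + 1 ≤ ∑ i, s i := by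
      unfold cld at hlt
      push Not at hlt
      have h1 := (Nat.le_div_iff_mul_le (by omega : 0 < r - 1)).1 (Nat.succ_le_of_lt hlt)
      rw [Nat.succ_mul, mul_comm m (r - 1)] at h1
      omega
    obtain ⟨A, h1, h2, h3⟩ := MM_all r (by omega) (Fin n) s m k (fun A => (c A).val)
      (fun A => (c A).isLt) hk (fun i => (hsr i).trans (by omega)) hbig
    exact hc A h1 h2 fun j j' => Fin.ext (h3 j j')
end
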